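/- arXiv:1910.07505 — 14 statements merged into one kernel-verified Lean document; each statement's English description precedes it below -/
import Mathlib

section
/- Let G be an infinite group. Then there exist ultrafilters v₀, v₁ ∈ βG such that for every non-principal ultrafilter u ∈ βG \ G one has u ⋄ v₀ ≠ u ∘ v₀ or u ⋄ v₁ ≠ u ∘ v₁; that is, {v₀, v₁} is a two-point DTC set for βG. -/
open scoped Pointwise

/-- The product `u ⋄ v` on ultrafilters: `A ∈ u ⋄ v ↔ {x | x⁻¹A ∈ v} ∈ u`. -/
def dprod {G : Type*} [Group G] (u v : Ultrafilter G) : Ultrafilter G :=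
  u.bind fun x => v.map fun y => x * y

/-- The product `u ∘ v` on ultrafilters: `A ∈ u ∘ v ↔ {x | Ax⁻¹ ∈ u} ∈ v`. -/
def cprod {G : Type*} [Group G] (u v : Ultrafilter G) : Ultrafilter G :=
  v.bind fun y => u.map fun x => x * y

/-- Membership characterization of `u ⋄ v`: here `{y | x * y ∈ A}` is the set `x⁻¹A`. -/
theorem mem_dprod {G : Type*} [Group G] (u v : Ultrafilter G) (A : Set G) :
    A ∈ dprod u v ↔ {x : G | {y : G | x * y ∈ A} ∈ v} ∈ u := Iff.rfl

/-- Membership characterization of `u ∘ v`: here `{x | x * y ∈ A}` is the set `Ay⁻¹`. -/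
theorem mem_cprod {G : Type*} [Group G] (u v : Ultrafilter G) (A : Set G) :
    A ∈ cprod u v ↔ {y : G | {x : G | x * y ∈ A} ∈ u} ∈ v := Iff.rfl

/-- `u ∈ βG` is principal, i.e. belongs to the copy of `G` inside `βG`. -/
def IsPrincipal {G : Type*} (u : Ultrafilter G) : Prop :=
  ∃ x : G, u = pure x

/-- `v` is a DTC ultrafilter for `βG`: `u ⋄ v ≠ u ∘ v` for every `u ∈ βG \ G`. -/
def IsDTC {G : Type*} [Group G] (v : Ultrafilter G) : Prop :=
  ∀ u : Ultrafilter G, ¬IsPrincipal u → dprod u v ≠ cprod u v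


universe u

/-- Transfinite choice of a family avoiding small sets determined by the previous values. -/
theorem exists_family_notMem {ι G : Type*} [LinearOrder ι] [WellFoundedLT ι]
    (B : ι → Set G → Set G) (h : ∀ l (f : Set.Iio l → G), ∃ g, g ∉ B l (Set.range f)) :
    ∃ y : ι → G, ∀ l, y l ∉ B l (y '' Set.Iio l) := by
  choose c hc using h
  let y : ι → G := (wellFounded_lt (α := ι)).fix fun l rec => c l fun m => rec m.1 m.2
  have hy : ∀ l, y l = c l fun m => y m.1 := fun l => WellFounded.fix_eq _ _ l
  refine ⟨y, fun l => ?_⟩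
  rw [hy l, Set.image_eq_range]
  exact hc l _

open Cardinal in
theorem mk_iUnion_finset_lt {ι G : Type u} (F : ι → Finset G) {c : Cardinal.{u}}
    (hc : ℵ₀ ≤ c) (hι : #ι < c) : #(⋃ i, (F i : Set G) : Set G) < c := by
  rcases finite_or_infinite ι with h | h
  · exact (Set.finite_iUnion fun i => (F i).finite_toSet).lt_aleph0.trans_le hc
  · refine lt_of_le_of_lt ?_ hι
    calc #(⋃ i, (F i : Set G) : Set G) ≤ sum fun i => #(F i : Set G) := mk_iUnion_le_sum_mk
      _ ≤ sum fun _ : ι => (ℵ₀ : Cardinal.{u}) :=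
        sum_le_sum _ _ fun i => (F i).finite_toSet.lt_aleph0.le
      _ = #ι := by rw [sum_const', mul_aleph0_eq (aleph0_le_mk ι)]

/-- The products of elements of `T` and their inverses of the two shapes to be avoided. -/
def forbiddenWords {G : Type*} [Group G] (T : Set G) : Set G :=
  T⁻¹ * T * T * T⁻¹ * T ∪ T * T⁻¹ * T⁻¹ * T * T * T⁻¹ * T

open Cardinal in
theorem mk_forbiddenWords_lt {G : Type*} [Group G] {T : Set G} {c : Cardinal}
    (hc : ℵ₀ ≤ c) (hT : #T < c) : #(forbiddenWords T) < c := by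
  have hmul : ∀ {A B : Set G}, #A < c → #B < c → #(A * B : Set G) < c :=
    fun hA hB => mk_mul_le.trans_lt (mul_lt_of_lt hc hA hB)
  have hinv : #(T⁻¹ : Set G) < c := by rwa [mk_inv]
  refine (mk_union_le _ _).trans_lt (add_lt_of_lt hc ?_ ?_)
  · exact hmul (hmul (hmul (hmul hinv hT) hT) hinv) hT
  · exact hmul (hmul (hmul (hmul (hmul (hmul hT hinv) hinv) hT) hT) hinv) hT

/-- The union of the sets `F n` for `n ≤ l`. -/
def initialUnion {ι G : Type*} [LinearOrder ι] (F : ι → Finset G) (l : ι) : Set G :=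
  ⋃ n : Set.Iic l, (F n : Set G)

/-- The values `y n` for `n < l` together with the members of `F n` for `n ≤ l`. -/
def previousElements {ι G : Type*} [LinearOrder ι] (F : ι → Finset G) (y : ι → G) (l : ι) :
    Set G :=
  y '' Set.Iio l ∪ initialUnion F l

theorem apply_mem_previousElements {ι G : Type*} [LinearOrder ι] {F : ι → Finset G} {y : ι → G}
    {n l : ι} (h : n < l) : y n ∈ previousElements F y l :=
  Or.inl ⟨n, h, rfl⟩

theorem mem_previousElements {ι G : Type*} [LinearOrder ι] {F : ι → Finset G} {y : ι → G}
    {n l : ι} (h : n ≤ l) {x : G} (hx : x ∈ F n) : x ∈ previousElements F y l :=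
  Or.inr (Set.mem_iUnion.2 ⟨⟨n, h⟩, hx⟩)

open Cardinal in
theorem exists_sparse_family {ι G : Type u} [Group G] [LinearOrder ι] [WellFoundedLT ι]
    [NoMaxOrder ι] (hG : ℵ₀ ≤ #G) (hι : ∀ l : ι, #(Set.Iio l) < #G) (F : ι → Finset G) :
    ∃ y : ι → G, ∀ l, y l ∉ forbiddenWords (previousElements F y l) := by
  suffices h : ∀ l (f : Set.Iio l → G),
      ∃ g, g ∉ forbiddenWords (Set.range f ∪ initialUnion F l) by
    obtain ⟨y, hy⟩ := exists_family_notMem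
      (fun l S => forbiddenWords (S ∪ initialUnion F l)) h
    exact ⟨y, hy⟩
  intro l f
  have hIic : #(Set.Iic l) < #G := by
    obtain ⟨m, hm⟩ := exists_gt l
    exact (mk_le_mk_of_subset fun x hx => lt_of_le_of_lt hx hm).trans_lt (hι m)
  have hlt : #(forbiddenWords (Set.range f ∪ initialUnion F l)) < #G := by
    refine mk_forbiddenWords_lt hG ((mk_union_le _ _).trans_lt (add_lt_of_lt hG ?_ ?_))
    · exact mk_range_le.trans_lt (hι l)
    · exact mk_iUnion_finset_lt (fun n : Set.Iic l => F n) hG hIic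
  by_contra! h
  rw [Set.eq_univ_of_forall h, mk_univ] at hlt
  exact hlt.false

/-- If `y` is sparse, then the equation `f * y n * (y m)⁻¹ = f' * y l * (y k)⁻¹` with `n < l`
forces `l` to be bounded by `m` or `k`. -/
theorem le_max_of_mul_eq {ι G : Type*} [Group G] [LinearOrder ι] {F : ι → Finset G} {y : ι → G}
    (hy : ∀ l, y l ∉ forbiddenWords (previousElements F y l)) {n l m k : ι} {f f' : G}
    (hf : f ∈ F n) (hf' : f' ∈ F l) (hnl : n < l)
    (h : f * y n * (y m)⁻¹ = f' * y l * (y k)⁻¹) : l ≤ max m k := by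
  by_contra! hl
  obtain ⟨hm, hk⟩ := max_lt_iff.1 hl
  refine hy l (Or.inl ?_)
  have e : y l = f'⁻¹ * f * y n * (y m)⁻¹ * y k := by
    rw [eq_mul_inv_iff_mul_eq, ← eq_inv_mul_iff_mul_eq] at h
    have h' := congrArg (f'⁻¹ * (f * y n * (y m)⁻¹) * ·) h
    simpa [mul_assoc] using h'.symm
  rw [e]
  refine Set.mul_mem_mul (Set.mul_mem_mul (Set.mul_mem_mul (Set.mul_mem_mul ?_ ?_) ?_) ?_) ?_
  · exact Set.inv_mem_inv.2 (mem_previousElements le_rfl hf')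
  · exact mem_previousElements hnl.le hf
  · exact apply_mem_previousElements hnl
  · exact Set.inv_mem_inv.2 (apply_mem_previousElements hm)
  · exact apply_mem_previousElements hk

/-- If `y` is sparse and `a`, `b` are of the form `f * y n * (y m)⁻¹` with all indices below `l`,
then `a * y l` and `b * y k` are distinct for `k < l`. -/
theorem mul_ne_mul_of_lt {ι G : Type*} [Group G] [LinearOrder ι] {F : ι → Finset G} {y : ι → G}
    (hy : ∀ l, y l ∉ forbiddenWords (previousElements F y l)) {m p l k : ι} (hmp : m ≤ p)
    (hpl : p < l) (hkl : k < l) {a b : G}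
    (ha : ∃ n ≤ p, ∃ f ∈ F n, a = f * y n * (y m)⁻¹)
    (hb : ∃ n ≤ p, ∃ f ∈ F n, b = f * y n * (y m)⁻¹) : a * y l ≠ b * y k := by
  obtain ⟨n, hn, f, hf, rfl⟩ := ha
  obtain ⟨n', hn', f', hf', rfl⟩ := hb
  intro h
  refine hy l (Or.inr ?_)
  have e : y l = y m * (y n)⁻¹ * f⁻¹ * f' * y n' * (y m)⁻¹ * y k := by
    rw [← eq_inv_mul_iff_mul_eq] at h
    rw [h]
    group
  rw [e]
  have hml := apply_mem_previousElements (F := F) (y := y) (hmp.trans_lt hpl)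
  refine Set.mul_mem_mul (Set.mul_mem_mul (Set.mul_mem_mul (Set.mul_mem_mul (Set.mul_mem_mul
    (Set.mul_mem_mul hml ?_) ?_) ?_) ?_) (Set.inv_mem_inv.2 hml)) ?_
  · exact Set.inv_mem_inv.2 (apply_mem_previousElements (hn.trans_lt hpl))
  · exact Set.inv_mem_inv.2 (mem_previousElements (hn.trans hpl.le) hf)
  · exact mem_previousElements (hn'.trans hpl.le) hf'
  · exact apply_mem_previousElements (hn'.trans_lt hpl)
  · exact apply_mem_previousElements hkl

/-- The set of products `x * y l` with `x ∈ F l ∩ C` and `l ∈ J`. -/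
def partialProducts {ι G : Type*} [Group G] (F : ι → Finset G) (y : ι → G) (C : Set G)
    (J : Set ι) : Set G :=
  {g | ∃ l ∈ J, ∃ x ∈ F l, x ∈ C ∧ g = x * y l}

theorem eventually_mem_of_dprod_eq_cprod {ι G : Type*} [Group G] {F : ι → Finset G} {y : ι → G}
    {w : Ultrafilter ι} (hw : ∀ x, ∀ᶠ l in w, x ∈ F l) {u : Ultrafilter G}
    (h : dprod u (w.map y) = cprod u (w.map y)) {C : Set G} (hC : C ∈ u) {J : Set ι}
    (hJ : J ∈ w) : ∀ᶠ m in w, {x | x * y m ∈ partialProducts F y C J} ∈ u := by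
  have hd : partialProducts F y C J ∈ dprod u (w.map y) := by
    refine (mem_dprod _ _ _).2 (Filter.mem_of_superset hC fun x hx => ?_)
    filter_upwards [hw x, hJ] with l hl hlJ
    exact ⟨l, hlJ, x, hl, hx, rfl⟩
  rw [h] at hd
  exact hd

theorem isPrincipal_of_dprod_eq_cprod {ι G : Type*} [Group G] [LinearOrder ι]
    {F : ι → Finset G} {y : ι → G}
    (hy : ∀ l, y l ∉ forbiddenWords (previousElements F y l)) {J₀ J₁ : Set ι}
    (hJ : Disjoint J₀ J₁) {w₀ w₁ : Ultrafilter ι} (hJ₀ : J₀ ∈ w₀) (hJ₁ : J₁ ∈ w₁)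
    (hF₀ : ∀ x, ∀ᶠ l in w₀, x ∈ F l) (hF₁ : ∀ x, ∀ᶠ l in w₁, x ∈ F l)
    (hgt : ∀ p, ∀ᶠ l in (w₀ : Filter ι), p < l) {u : Ultrafilter G}
    (h₀ : dprod u (w₀.map y) = cprod u (w₀.map y))
    (h₁ : dprod u (w₁.map y) = cprod u (w₁.map y)) : IsPrincipal u := by
  obtain ⟨m, hm⟩ :=
    (eventually_mem_of_dprod_eq_cprod hF₀ h₀ Filter.univ_mem hJ₀).exists
  obtain ⟨k, hk⟩ :=
    (eventually_mem_of_dprod_eq_cprod hF₁ h₁ Filter.univ_mem hJ₁).exists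
  set p := max m k
  set C : Set G := {x | ∃ n ≤ p, ∃ f ∈ F n, x = f * y n * (y m)⁻¹}
  have hC : C ∈ u := by
    filter_upwards [hm, hk]
    rintro x ⟨n, hn, f, hf, -, hx⟩ ⟨l, hl, f', hf', -, hx'⟩
    rw [← eq_mul_inv_iff_mul_eq] at hx hx'
    refine ⟨n, ?_, f, hf, hx⟩
    rcases lt_or_gt_of_ne (hJ.ne_of_mem hn hl) with hnl | hln
    · exact hnl.le.trans (le_max_of_mul_eq hy hf hf' hnl (hx.symm.trans hx'))
    · exact (le_max_of_mul_eq hy hf' hf hln (hx'.symm.trans hx)).trans_eq (max_comm k m)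
  obtain ⟨r, hr, hpr⟩ :=
    ((eventually_mem_of_dprod_eq_cprod hF₀ h₀ hC (hgt p)).and (hgt p)).exists
  have hfin : (F r : Set G) ∈ u := by
    filter_upwards [hr, hC]
    rintro x ⟨l, hl, c, hcl, hc, hx⟩ hxC
    rcases lt_trichotomy l r with hlr | rfl | hrl
    · exact (mul_ne_mul_of_lt hy (le_max_left m k) hpr hlr hxC hc hx).elim
    · rwa [mul_right_cancel hx]
    · exact (mul_ne_mul_of_lt hy (le_max_left m k) hl hrl hc hxC hx.symm).elim
  obtain ⟨x, -, hx⟩ := Ultrafilter.eq_pure_of_finite_mem (F r).finite_toSet hfin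
  exact ⟨x, hx⟩

open Cardinal in
/-- If every triple `(s, g, b)` is the label of some index, then there is an ultrafilter on the
indices which contains all final segments, a given colour class, and is `#G`-regular. -/
theorem exists_regular_ultrafilter {ι G : Type u} [LinearOrder ι] [NoMaxOrder ι] [Nonempty ι]
    (hι : ∀ l : ι, #(Set.Iio l) < #G) (e : ι ≃ Finset G × G × Bool) (b : Bool) :
    ∃ w : Ultrafilter ι, {l | (e l).2.2 = b} ∈ w ∧ (∀ x, ∀ᶠ l in w, x ∈ (e l).1) ∧
      ∀ p, ∀ᶠ l in (w : Filter ι), p < l := by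
  classical
  let φ : Filter ι := (Filter.atTop ⊓ Filter.comap (fun l => (e l).1) Filter.atTop) ⊓
    Filter.principal {l | (e l).2.2 = b}
  have hφ : φ.NeBot := by
    refine ((Filter.atTop_basis.inf (Filter.atTop_basis.comap _)).inf_principal_neBot_iff).2 ?_
    rintro ⟨p, s⟩ -
    by_contra hne
    have hsub : ∀ g : G, e.symm (s, g, b) ∈ Set.Iio p := by
      intro g
      by_contra hg
      exact hne ⟨e.symm (s, g, b), ⟨not_lt.1 hg, by simp⟩, by simp⟩
    have hinj : Function.Injective fun g : G => (⟨e.symm (s, g, b), hsub g⟩ : Set.Iio p) := by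
      intro g g' h
      simpa using h
    exact ((mk_le_of_injective hinj).trans_lt (hι p)).false
  refine ⟨Ultrafilter.of φ, Ultrafilter.of_le φ ?_, fun x => Ultrafilter.of_le φ ?_,
    fun p => Ultrafilter.of_le φ ?_⟩
  · exact Filter.mem_inf_of_right (Filter.mem_principal_self _)
  · refine Filter.mem_inf_of_left (Filter.mem_inf_of_right ?_)
    exact ⟨Set.Ici {x}, Filter.Ici_mem_atTop _, fun l hl => Finset.singleton_subset_iff.1 hl⟩
  · exact Filter.mem_inf_of_left (Filter.mem_inf_of_left (Filter.Ioi_mem_atTop p))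

/-- Theorem (two-point DTC set): for every infinite group `G` there are ultrafilters
`v₀, v₁ ∈ βG` forming a two-point DTC set: for every non-principal `u ∈ βG \ G`,
`u ⋄ v₀ ≠ u ∘ v₀` or `u ⋄ v₁ ≠ u ∘ v₁`. -/
theorem two_point_DTC_set (G : Type*) [Group G] [Infinite G] :
    ∃ v₀ v₁ : Ultrafilter G, ∀ u : Ultrafilter G, ¬IsPrincipal u →
      (dprod u v₀ ≠ cprod u v₀ ∨ dprod u v₁ ≠ cprod u v₁) := by
  have hG : Cardinal.aleph0 ≤ Cardinal.mk G := Cardinal.aleph0_le_mk G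
  let ι := (Cardinal.mk G).ord.ToType
  have : NoMaxOrder ι := Cardinal.noMaxOrder hG
  have hι : ∀ l : ι, Cardinal.mk (Set.Iio l) < Cardinal.mk G := fun l => by
    simpa [ι] using Cardinal.mk_Iio_lt l (by simp [ι])
  have hcard : Cardinal.mk ι = Cardinal.mk (Finset G × G × Bool) := by
    have h2 : (2 : Cardinal) ≤ Cardinal.mk G := (Cardinal.ofNat_lt_aleph0 (n := 2)).le.trans hG
    simp [ι, Cardinal.mul_eq_left hG h2, Cardinal.mul_eq_self hG]
  obtain ⟨e⟩ := Cardinal.eq.1 hcard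
  have : Nonempty ι := ⟨e.symm (∅, 1, true)⟩
  obtain ⟨y, hy⟩ := exists_sparse_family hG hι fun l => (e l).1
  obtain ⟨w₀, hJ₀, hF₀, hgt⟩ := exists_regular_ultrafilter hι e false
  obtain ⟨w₁, hJ₁, hF₁, -⟩ := exists_regular_ultrafilter hι e true
  refine ⟨w₀.map y, w₁.map y, fun u hu => ?_⟩
  by_contra! h
  have hJ : Disjoint {l | (e l).2.2 = false} {l | (e l).2.2 = true} :=
    Set.disjoint_left.2 fun l hl hl' => Bool.false_ne_true (hl.symm.trans hl')
  exact hu (isPrincipal_of_dprod_eq_cprod hy hJ hJ₀ hJ₁ hF₀ hF₁ hgt h.1 h.2)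
end

section
/- Let G be an infinite group and A an index set with |A| = |G|, and for each α ∈ A let F_α be a finite subset of G. Then there exist elements z_α ∈ G (α ∈ A) such that F_α z_α z_γ⁻¹ ∩ F_β z_β z_δ⁻¹ = ∅ whenever α, β, γ, δ are four pairwise distinct elements of A. -/
open scoped Pointwise

/-- Transfinite recursion avoiding, at each stage, a set determined by the previous choices. -/
theorem exists_forall_notMem_of_wellFoundedLT {ι X : Type*} [Preorder ι] [WellFoundedLT ι]
    (E : ∀ i : ι, (Set.Iio i → X) → Set X) (hE : ∀ i p, ∃ x, x ∉ E i p) :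
    ∃ z : ι → X, ∀ i, z i ∉ E i (fun j => z j) := by
  choose next hnext using hE
  let step (i : ι) (p : ∀ j, j < i → X) : X := next i fun j => p j j.2
  refine ⟨WellFoundedLT.fix step, fun i => ?_⟩
  rw [WellFoundedLT.fix_eq step i]
  exact hnext i _

universe u

open Cardinal in
/-- A union of fewer than `c` finite sets has fewer than `c` elements, for `c` infinite. -/
theorem mk_biUnion_finset_lt {ι X : Type u} {c : Cardinal.{u}} (hc : ℵ₀ ≤ c) {s : Set ι}
    (hs : #s < c) (F : ι → Finset X) : #(⋃ i ∈ s, (F i : Set X)) < c := by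
  rcases s.finite_or_infinite with hfin | hinf
  · exact (hfin.biUnion fun i _ => (F i).finite_toSet).lt_aleph0.trans_le hc
  · have hs' : ℵ₀ ≤ #s := Cardinal.infinite_iff.mp hinf.to_subtype
    refine lt_of_le_of_lt ((mk_biUnion_le _ s).trans ?_) hs
    calc #s * ⨆ i : s, #(F i : Set X)
        ≤ #s * ℵ₀ := by
          gcongr
          exact ciSup_le' fun i => (F i).finite_toSet.lt_aleph0.le
      _ = #s := mul_eq_left hs' hs' aleph0_ne_zero

open Cardinal in
/-- Products of fivefold words over a small subset of an infinite group do not exhaust it. -/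
theorem exists_notMem_mul_of_mk_lt {G : Type*} [Group G] [Infinite G] {T : Set G}
    (hT : #T < #G) : ∃ x, x ∉ T * T * T * T * T := by
  have hmul {s t : Set G} (hs : #s < #G) (ht : #t < #G) : #(s * t : Set G) < #G :=
    mk_mul_le.trans_lt (mul_lt_of_lt (aleph0_le_mk G) hs ht)
  by_contra! h
  have hlt := hmul (hmul (hmul (hmul hT hT) hT) hT) hT
  rw [Set.eq_univ_of_forall h, mk_univ] at hlt
  exact hlt.false

/-- The elements of the `F j` with `j ≤ i` and of `p`, together with their inverses. -/
def symmetricSupport {ι G : Type*} [Group G] [Preorder ι] (F : ι → Finset G) (i : ι)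
    (p : Set.Iio i → G) : Set G :=
  ((⋃ j ∈ Set.Iic i, (F j : Set G)) ∪ Set.range p) ∪
    ((⋃ j ∈ Set.Iic i, (F j : Set G)) ∪ Set.range p)⁻¹

open Cardinal in
theorem mk_symmetricSupport_lt {ι G : Type u} [Group G] [Infinite G] [LinearOrder ι]
    (F : ι → Finset G) (i : ι) (p : Set.Iio i → G) (hi : #(Set.Iio i) < #G) :
    #(symmetricSupport F i p) < #G := by
  have hG : ℵ₀ ≤ #G := aleph0_le_mk G
  have hIic : #(Set.Iic i) < #G := by
    rw [← Set.Iio_insert]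
    exact mk_insert_le.trans_lt (add_lt_of_lt hG hi (one_lt_aleph0.trans_le hG))
  have hS : #((⋃ j ∈ Set.Iic i, (F j : Set G)) ∪ Set.range p : Set G) < #G :=
    (mk_union_le _ _).trans_lt
      (add_lt_of_lt hG (mk_biUnion_finset_lt hG hIic F) (mk_range_le.trans_lt hi))
  exact (mk_union_le _ _).trans_lt (add_lt_of_lt hG hS (by rwa [mk_inv]))

section symmetricSupport

variable {ι G : Type*} [Group G] [Preorder ι] {F : ι → Finset G} {i j : ι} {p : Set.Iio i → G}

theorem inv_mem_symmetricSupport {x : G} (hx : x ∈ symmetricSupport F i p) :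
    x⁻¹ ∈ symmetricSupport F i p := by
  rcases hx with hx | hx
  · exact Or.inr (by simpa using hx)
  · exact Or.inl hx

theorem mem_symmetricSupport_of_mem {x : G} (hj : j ≤ i) (hx : x ∈ F j) :
    x ∈ symmetricSupport F i p :=
  Or.inl (Or.inl (Set.mem_biUnion (Set.mem_Iic.mpr hj) hx))

theorem apply_mem_symmetricSupport {z : ι → G} (hj : j < i) :
    z j ∈ symmetricSupport F i (fun k => z k) :=
  Or.inl (Or.inr ⟨⟨j, hj⟩, rfl⟩)

end symmetricSupport

open Cardinal in
/-- The separation property for families indexed by an initial well-order. -/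
theorem exists_separating_of_mk_Iio_lt {ι G : Type u} [Group G] [Infinite G] [LinearOrder ι]
    [WellFoundedLT ι] (hι : ∀ i : ι, #(Set.Iio i) < #G) (F : ι → Finset G) :
    ∃ z : ι → G, ∀ α β γ δ : ι,
      α ≠ β → α ≠ γ → α ≠ δ → β ≠ γ → β ≠ δ → γ ≠ δ →
      ∀ f ∈ F α, ∀ g ∈ F β, f * (z α * (z γ)⁻¹) ≠ g * (z β * (z δ)⁻¹) := by
  obtain ⟨z, hz⟩ := exists_forall_notMem_of_wellFoundedLT
    (fun i p => symmetricSupport F i p * symmetricSupport F i p * symmetricSupport F i p *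
      symmetricSupport F i p * symmetricSupport F i p)
    (fun i p => exists_notMem_mul_of_mk_lt (mk_symmetricSupport_lt F i p (hι i)))
  have hz' {i : ι} {a b c d e : G} (ha : a ∈ symmetricSupport F i fun j => z j)
      (hb : b ∈ symmetricSupport F i fun j => z j) (hc : c ∈ symmetricSupport F i fun j => z j)
      (hd : d ∈ symmetricSupport F i fun j => z j) (he : e ∈ symmetricSupport F i fun j => z j) :
      z i ≠ a * b * c * d * e := fun h =>
    hz i (h ▸ Set.mul_mem_mul (Set.mul_mem_mul (Set.mul_mem_mul (Set.mul_mem_mul ha hb) hc) hd) he)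
  have left_max {α β γ δ : ι} (hβ : β < α) (hγ : γ < α) (hδ : δ < α) {f g : G} (hf : f ∈ F α)
      (hg : g ∈ F β) : f * (z α * (z γ)⁻¹) ≠ g * (z β * (z δ)⁻¹) := fun h =>
    hz' (inv_mem_symmetricSupport (mem_symmetricSupport_of_mem le_rfl hf))
      (mem_symmetricSupport_of_mem hβ.le hg) (apply_mem_symmetricSupport hβ)
      (inv_mem_symmetricSupport (apply_mem_symmetricSupport hδ)) (apply_mem_symmetricSupport hγ)
      (calc z α = f⁻¹ * (f * (z α * (z γ)⁻¹)) * z γ := by group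
        _ = f⁻¹ * g * z β * (z δ)⁻¹ * z γ := by rw [h]; group)
  have right_max {α β γ δ : ι} (hα : α < γ) (hβ : β < γ) (hδ : δ < γ) {f g : G} (hf : f ∈ F α)
      (hg : g ∈ F β) : f * (z α * (z γ)⁻¹) ≠ g * (z β * (z δ)⁻¹) := fun h =>
    hz' (apply_mem_symmetricSupport hδ) (inv_mem_symmetricSupport (apply_mem_symmetricSupport hβ))
      (inv_mem_symmetricSupport (mem_symmetricSupport_of_mem hβ.le hg))
      (mem_symmetricSupport_of_mem hα.le hf) (apply_mem_symmetricSupport hα)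
      (calc z γ = (f * (z α * (z γ)⁻¹))⁻¹ * f * z α := by group
        _ = z δ * (z β)⁻¹ * g⁻¹ * f * z α := by rw [h]; group)
  refine ⟨z, fun α β γ δ hαβ hαγ hαδ hβγ hβδ hγδ f hf g hg => ?_⟩
  have hmax : (β < α ∧ γ < α ∧ δ < α) ∨ (α < β ∧ γ < β ∧ δ < β) ∨
      (α < γ ∧ β < γ ∧ δ < γ) ∨ (α < δ ∧ β < δ ∧ γ < δ) := by grind
  rcases hmax with ⟨h₁, h₂, h₃⟩ | ⟨h₁, h₂, h₃⟩ | ⟨h₁, h₂, h₃⟩ | ⟨h₁, h₂, h₃⟩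
  · exact left_max h₁ h₂ h₃ hf hg
  · exact (left_max h₁ h₃ h₂ hg hf).symm
  · exact right_max h₁ h₂ h₃ hf hg
  · exact (right_max h₂ h₁ h₃ hg hf).symm

/-- Separation lemma: if `|A| = |G|` and `F α` is a finite subset of `G` for each `α ∈ A`,
then there are `z α ∈ G` with `F α * z α * (z γ)⁻¹ ∩ F β * z β * (z δ)⁻¹ = ∅`
whenever `α, β, γ, δ` are pairwise distinct. -/
theorem separation_lemma (G : Type*) [Group G] [Infinite G] (A : Type*)
    (hcard : Nonempty (A ≃ G)) (F : A → Finset G) :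
    ∃ z : A → G, ∀ α β γ δ : A,
      α ≠ β → α ≠ γ → α ≠ δ → β ≠ γ → β ≠ δ → γ ≠ δ →
      ((F α : Set G) * {z α * (z γ)⁻¹}) ∩ ((F β : Set G) * {z β * (z δ)⁻¹}) = ∅ := by
  obtain ⟨e⟩ := hcard
  obtain ⟨_, _, hord⟩ := Cardinal.exists_ord_eq_type_lt G
  obtain ⟨z, hz⟩ := exists_separating_of_mk_Iio_lt (fun i : G => Cardinal.mk_Iio_lt i hord)
    (F ∘ e.symm)
  refine ⟨z ∘ e, fun α β γ δ hαβ hαγ hαδ hβγ hβδ hγδ => ?_⟩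
  rw [← Set.disjoint_iff_inter_eq_empty, Set.disjoint_left]
  rintro _ ⟨f, hf, _, rfl, rfl⟩ ⟨g, hg, _, rfl, h⟩
  exact hz (e α) (e β) (e γ) (e δ) (by simpa) (by simpa) (by simpa) (by simpa) (by simpa)
    (by simpa) f (by simpa using hf) g (by simpa using hg) h.symm
end

section
/- Let G be an infinite group and H a subgroup of G of finite index. Then G admits a DTC ultrafilter if and only if H admits a DTC ultrafilter (i.e., G is DTC(1) if and only if H is DTC(1)). -/
open scoped Pointwise

/-- Every ultrafilter on `G` is a left translate of one on the finite-index subgroup `H`. -/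
theorem exists_eq_map_mul_left {G : Type*} [Group G] (H : Subgroup G) [H.FiniteIndex]
    (u : Ultrafilter G) : ∃ (g : G) (w : Ultrafilter H), u = w.map fun h : H => g * (h : G) := by
  obtain ⟨q, hq⟩ := Ultrafilter.eq_pure_of_finite (u.map ((↑) : G → G ⧸ H))
  obtain ⟨g, rfl⟩ := QuotientGroup.mk_surjective q
  have hinj : Function.Injective fun h : H => g * (h : G) :=
    (mul_right_injective g).comp Subtype.val_injective
  have hmem : {x : G | (x : G ⧸ H) = g} ∈ u := by
    have h : ({(g : G ⧸ H)} : Set (G ⧸ H)) ∈ u.map ((↑) : G → G ⧸ H) := by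
      rw [hq]
      exact Ultrafilter.mem_pure.2 rfl
    exact h
  have hrange : Set.range (fun h : H => g * (h : G)) ∈ u := by
    filter_upwards [hmem] with x hx
    exact ⟨⟨g⁻¹ * x, QuotientGroup.eq.1 hx.symm⟩, mul_inv_cancel_left g x⟩
  refine ⟨g, u.comap hinj hrange, Ultrafilter.coe_injective ?_⟩
  rw [Ultrafilter.coe_map, Ultrafilter.coe_comap, Filter.map_comap_of_mem hrange]

/-- Every ultrafilter on `G` is a right translate of one on the finite-index subgroup `H`. -/
theorem exists_eq_map_mul_right {G : Type*} [Group G] (H : Subgroup G) [H.FiniteIndex]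
    (u : Ultrafilter G) : ∃ (g : G) (w : Ultrafilter H), u = w.map fun h : H => (h : G) * g := by
  obtain ⟨g, w, hw⟩ := exists_eq_map_mul_left H (u.map fun x => x⁻¹)
  refine ⟨g⁻¹, w.map fun h => h⁻¹, ?_⟩
  have h : (u.map fun x => x⁻¹).map (fun x => x⁻¹) = u := by
    simp [Ultrafilter.map_map]
  rw [← h, hw]
  simp [Ultrafilter.map_map, Function.comp_def]

theorem Ultrafilter.map_injective_of_injective {α β : Type*} {f : α → β}
    (hf : Function.Injective f) : Function.Injective (Ultrafilter.map f) := fun _ _ h =>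
  Ultrafilter.coe_injective (Filter.map_injective hf (congrArg Ultrafilter.toFilter h))

theorem IsPrincipal.map {α β : Type*} {u : Ultrafilter α} (hu : IsPrincipal u) (f : α → β) :
    IsPrincipal (u.map f) := by
  obtain ⟨x, rfl⟩ := hu
  exact ⟨f x, Ultrafilter.map_pure f x⟩

theorem isPrincipal_map_iff {α β : Type*} {f : α → β} (hf : Function.Injective f)
    {u : Ultrafilter α} : IsPrincipal (u.map f) ↔ IsPrincipal u := by
  refine ⟨fun ⟨y, hy⟩ => ?_, fun hu => hu.map f⟩
  have h : Set.range f ∩ {y} ∈ u.map f :=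
    Filter.inter_mem Filter.range_mem_map (by rw [hy]; exact Ultrafilter.mem_pure.2 rfl)
  obtain ⟨_, ⟨x, rfl⟩, rfl⟩ := Ultrafilter.nonempty_of_mem h
  exact ⟨x, Ultrafilter.map_injective_of_injective hf (by rw [hy, Ultrafilter.map_pure])⟩

theorem dprod_map_map {G H : Type*} [Group G] [Group H] {f₁ f₂ f : H → G}
    (hf : ∀ x y, f₁ x * f₂ y = f (x * y)) (u v : Ultrafilter H) :
    dprod (u.map f₁) (v.map f₂) = (dprod u v).map f := by
  ext A
  simp only [mem_dprod, Ultrafilter.mem_map, Set.preimage_ofPred_eq, Set.mem_preimage, hf]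

theorem cprod_map_map {G H : Type*} [Group G] [Group H] {f₁ f₂ f : H → G}
    (hf : ∀ x y, f₁ x * f₂ y = f (x * y)) (u v : Ultrafilter H) :
    cprod (u.map f₁) (v.map f₂) = (cprod u v).map f := by
  ext A
  simp only [mem_cprod, Ultrafilter.mem_map, Set.preimage_ofPred_eq, Set.mem_preimage, hf]

/-- If `H` is a subgroup of finite index of the infinite group `G`, then
`G` admits a DTC ultrafilter iff `H` does. -/
theorem dtc_iff_of_finiteIndex (G : Type*) [Group G] [Infinite G]
    (H : Subgroup G) (hH : H.FiniteIndex) :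
    (∃ v : Ultrafilter G, IsDTC v) ↔ (∃ v : Ultrafilter ↥H, IsDTC v) := by
  constructor
  · rintro ⟨v, hv⟩
    obtain ⟨g, w, rfl⟩ := exists_eq_map_mul_right H v
    refine ⟨w, fun u hu h => hv (u.map Subtype.val) ?_ ?_⟩
    · rwa [isPrincipal_map_iff Subtype.val_injective]
    · have hf : ∀ x y : H, (x : G) * ((y : G) * g) = ((x * y : H) : G) * g := fun x y => by
        rw [H.coe_mul, mul_assoc]
      rw [dprod_map_map (f := fun h : H => (h : G) * g) hf,
        cprod_map_map (f := fun h : H => (h : G) * g) hf, h]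
  · rintro ⟨v, hv⟩
    refine ⟨v.map Subtype.val, fun u hu h => ?_⟩
    obtain ⟨g, w, rfl⟩ := exists_eq_map_mul_left H u
    have hinj : Function.Injective fun h : H => g * (h : G) :=
      (mul_right_injective g).comp Subtype.val_injective
    refine hv w (fun hw => hu (hw.map _)) (Ultrafilter.map_injective_of_injective hinj ?_)
    have hf : ∀ x y : H, g * (x : G) * (y : G) = g * ((x * y : H) : G) := fun x y => by
      rw [H.coe_mul, mul_assoc]
    rwa [dprod_map_map (f := fun h : H => g * (h : G)) hf,
      cprod_map_map (f := fun h : H => g * (h : G)) hf] at h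
end

section
/- Let G be an infinite FC group for which there exists an integer n ≥ 1 such that xⁿy = yxⁿ for all x, y ∈ G. Then for all u, v ∈ βG one has v^{⋄n} ∘ u = u ⋄ v^{⋄n}, where v^{⋄1} := v and v^{⋄(k+1)} := v ⋄ v^{⋄k}. -/
open scoped Pointwise

/-- `dpow v n` is `v^{⋄n}`: `v^{⋄1} := v` and `v^{⋄(k+1)} := v ⋄ v^{⋄k}`. -/
def dpow {G : Type*} [Group G] (v : Ultrafilter G) : ℕ → Ultrafilter G
  | 0 => v
  | 1 => v
  | (k + 2) => dprod v (dpow v (k + 1))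

/-- A function to a finite type is constant on some member of a given ultrafilter. -/
theorem exists_eventually_eq_of_finite {G H : Type*} [Finite H] (f : G → H)
    (v : Ultrafilter G) : ∃ h : H, {x : G | f x = h} ∈ v := by
  obtain ⟨h, hh⟩ := Ultrafilter.eq_pure_of_finite (v.map f)
  refine ⟨h, ?_⟩
  have : ({h} : Set H) ∈ v.map f := by
    rw [hh]
    exact Ultrafilter.mem_pure.2 rfl
  exact Ultrafilter.mem_map.1 this

/-- If `φ` equals `h` almost everywhere for `v`, it equals `h ^ k` almost everywhere for
`v^{⋄k}`. -/
theorem eventually_map_eq_pow_dpow {G H : Type*} [Group G] [Group H] (φ : G →* H)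
    (v : Ultrafilter G) (h : H) (hv : {x : G | φ x = h} ∈ v) (k : ℕ) :
    {z : G | φ z = h ^ (k + 1)} ∈ dpow v (k + 1) := by
  induction k with
  | zero => simpa [dpow] using hv
  | succ k ih =>
    change _ ∈ dprod v (dpow v (k + 1))
    rw [mem_dprod]
    filter_upwards [hv] with x hx
    filter_upwards [ih] with z hz
    rw [pow_succ', map_mul, hx, hz]

/-- If `n`-th powers are central and `a` has finitely many conjugates, then
`v^{⋄n}`-almost every element commutes with `a`. -/
theorem eventually_commute_dpow {G : Type*} [Group G] (a : G)
    (ha : {z : G | ∃ x : G, x⁻¹ * a * x = z}.Finite)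
    (n : ℕ) (hn : 1 ≤ n) (hcomm : ∀ x y : G, x ^ n * y = y * x ^ n) (v : Ultrafilter G) :
    {z : G | z * a = a * z} ∈ dpow v n := by
  have hfin : (MulAction.orbit (ConjAct G) a).Finite := by
    refine ha.subset ?_
    rintro _ ⟨g, rfl⟩
    exact ⟨(ConjAct.ofConjAct g)⁻¹, by simp [ConjAct.smul_def]⟩
  have : Finite (MulAction.orbit (ConjAct G) a) := hfin
  let φ : G →* Equiv.Perm (MulAction.orbit (ConjAct G) a) :=
    (MulAction.toPermHom (ConjAct G) (MulAction.orbit (ConjAct G) a)).comp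
      ConjAct.toConjAct.toMonoidHom
  have hφ (g : G) : (φ g ⟨a, MulAction.mem_orbit_self a⟩ : G) = g * a * g⁻¹ := by
    change (ConjAct.toConjAct g • a) = _
    simp [ConjAct.smul_def]
  obtain ⟨h, hh⟩ := exists_eventually_eq_of_finite φ v
  obtain ⟨x, hx⟩ := Ultrafilter.nonempty_of_mem hh
  obtain ⟨k, rfl⟩ : ∃ k, n = k + 1 := ⟨n - 1, by omega⟩
  filter_upwards [eventually_map_eq_pow_dpow φ v h hh k] with z hz
  have hx' : φ x = h := hx
  have hz' : φ z = φ (x ^ (k + 1)) := by rw [map_pow, hx']; exact hz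
  have key : z * a * z⁻¹ = a := by
    rw [← hφ, hz', hφ, hcomm, mul_inv_cancel_right]
  exact mul_inv_eq_iff_eq_mul.1 key

/-- If `G` is an infinite FC group and `n ≥ 1` satisfies `xⁿy = yxⁿ` for all `x, y ∈ G`,
then `v^{⋄n} ∘ u = u ⋄ v^{⋄n}` for all `u, v ∈ βG`. -/
theorem pow_comm_in_betaG (G : Type*) [Group G] [Infinite G]
    (hFC : ∀ y : G, {z : G | ∃ x : G, x⁻¹ * y * x = z}.Finite)
    (n : ℕ) (hn : 1 ≤ n) (hcomm : ∀ x y : G, x ^ n * y = y * x ^ n) :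
    ∀ u v : Ultrafilter G, cprod (dpow v n) u = dprod u (dpow v n) := by
  intro u v
  ext A
  rw [mem_cprod, mem_dprod]
  have key (a : G) : {x : G | x * a ∈ A} ∈ dpow v n ↔ {x : G | a * x ∈ A} ∈ dpow v n := by
    have hc := eventually_commute_dpow a (hFC a) n hn hcomm v
    constructor <;> intro h <;> filter_upwards [h, hc] with z hz hza
    · rwa [← hza]
    · rwa [hza]
  simp only [key]
end

section
/- Let G be an infinite FC group for which there exists an integer n ≥ 1 such that xⁿy = yxⁿ for all x, y ∈ G. Then G does not admit a DTC ultrafilter: for every v ∈ βG \ G, the ultrafilter u := v^{⋄n} belongs to βG \ G and satisfies u ⋄ v = u ∘ v. -/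
open scoped Pointwise

theorem not_isPrincipal_of_singleton {G : Type*} {u : Ultrafilter G}
    (h : ∀ a : G, {a} ∉ u) : ¬IsPrincipal u := by
  rintro ⟨a, rfl⟩
  exact h a (Ultrafilter.mem_pure.2 rfl)

theorem singleton_notMem_of_not_isPrincipal {G : Type*} {u : Ultrafilter G}
    (h : ¬IsPrincipal u) (a : G) : {a} ∉ u := by
  intro ha
  obtain ⟨x, -, hx⟩ := Ultrafilter.eq_pure_of_finite_mem (Set.finite_singleton a) ha
  exact h ⟨x, hx⟩

theorem dprod_assoc {G : Type*} [Group G] (u v w : Ultrafilter G) :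
    dprod (dprod u v) w = dprod u (dprod v w) := by
  ext A
  simp only [mem_dprod, Set.mem_ofPred_eq, mul_assoc]

theorem dpow_add_one {G : Type*} [Group G] (v : Ultrafilter G) {n : ℕ} (hn : 1 ≤ n) :
    dpow v (n + 1) = dprod v (dpow v n) := by
  obtain ⟨k, rfl⟩ := Nat.exists_eq_add_of_le' hn
  rfl

theorem dprod_dpow_comm {G : Type*} [Group G] (v : Ultrafilter G) {n : ℕ} (hn : 1 ≤ n) :
    dprod (dpow v n) v = dprod v (dpow v n) := by
  induction n, hn using Nat.le_induction with
  | base => rfl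
  | succ k hk ih => rw [dpow_add_one v hk, dprod_assoc, ih]

theorem not_isPrincipal_dprod {G : Type*} [Group G] (u : Ultrafilter G) {v : Ultrafilter G}
    (hv : ¬IsPrincipal v) : ¬IsPrincipal (dprod u v) := by
  refine not_isPrincipal_of_singleton fun a ha => ?_
  rw [mem_dprod] at ha
  obtain ⟨x, hx⟩ := u.nonempty_of_mem ha
  refine singleton_notMem_of_not_isPrincipal hv (x⁻¹ * a) ?_
  filter_upwards [hx] with y hy
  exact eq_inv_mul_of_mul_eq hy

theorem not_isPrincipal_dpow {G : Type*} [Group G] {v : Ultrafilter G}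
    (hv : ¬IsPrincipal v) {n : ℕ} (hn : 1 ≤ n) : ¬IsPrincipal (dpow v n) := by
  induction n, hn using Nat.le_induction with
  | base => exact hv
  | succ k hk ih => rw [dpow_add_one v hk]; exact not_isPrincipal_dprod v ih

theorem preimage_pow_mem_dpow {G H : Type*} [Group G] [Group H] (f : G →* H)
    {v : Ultrafilter G} {h : H} (hv : {x | f x = h} ∈ v) {n : ℕ} (hn : 1 ≤ n) :
    {x | f x = h ^ n} ∈ dpow v n := by
  induction n, hn using Nat.le_induction with
  | base => rw [pow_one]; exact hv
  | succ k hk ih =>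
    rw [dpow_add_one v hk, mem_dprod]
    filter_upwards [hv] with x hx
    filter_upwards [ih] with y hy
    simp_all [pow_succ']

theorem exists_fiber_mem {G H : Type*} [Group G] [Group H] [Finite H] (f : G →* H)
    (v : Ultrafilter G) : ∃ g : G, {x | f x = f g} ∈ v := by
  obtain ⟨h, hh⟩ := Ultrafilter.eq_pure_of_finite (v.map f)
  have hv : {x | f x = h} ∈ v := by
    have : ({h} : Set H) ∈ v.map f := by rw [hh]; exact Ultrafilter.mem_pure.2 rfl
    exact this
  obtain ⟨g, rfl⟩ := v.nonempty_of_mem hv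
  exact ⟨g, hv⟩

/-- If `n`-th powers are central and `y` has finitely many conjugates, then `v^{⋄n}`
contains the centralizer of `y`. -/
theorem centralizer_mem_dpow {G : Type*} [Group G] {y : G}
    (hy : {z : G | ∃ x : G, x⁻¹ * y * x = z}.Finite)
    {n : ℕ} (hn : 1 ≤ n) (hcomm : ∀ x y : G, x ^ n * y = y * x ^ n) (v : Ultrafilter G) :
    {x : G | x * y = y * x} ∈ dpow v n := by
  have hfin : Finite (MulAction.orbit (ConjAct G) y) := by
    refine (hy.subset ?_).to_subtype
    rintro _ ⟨x, rfl⟩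
    exact ⟨(ConjAct.ofConjAct x)⁻¹, by simp [ConjAct.smul_def]⟩
  let f : G →* Equiv.Perm (MulAction.orbit (ConjAct G) y) :=
    (MulAction.toPermHom (ConjAct G) _).comp ConjAct.toConjAct.toMonoidHom
  have hf : ∀ x (z : MulAction.orbit (ConjAct G) y), (f x z : G) = x * z * x⁻¹ :=
    fun _ _ => rfl
  obtain ⟨g, hg⟩ := exists_fiber_mem f v
  filter_upwards [preimage_pow_mem_dpow f hg hn] with x hx
  have key := congrArg (fun p => (p ⟨y, MulAction.mem_orbit_self y⟩ : G)) hx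
  simp only [← map_pow, hf, hcomm, mul_inv_cancel_right] at key
  exact mul_inv_eq_iff_eq_mul.1 key

theorem dprod_eq_cprod_of_centralizer_mem {G : Type*} [Group G] {u v : Ultrafilter G}
    (h : ∀ y : G, {x : G | x * y = y * x} ∈ u) : dprod v u = cprod u v := by
  ext A
  rw [mem_dprod, mem_cprod]
  suffices ∀ y, {x | y * x ∈ A} ∈ u ↔ {x | x * y ∈ A} ∈ u by simp only [this]
  intro y
  constructor <;> intro hA <;> filter_upwards [h y, hA] with x hx hxA
  · simpa [hx] using hxA
  · simpa [hx] using hxA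

/-- If `G` is an infinite FC group and `n ≥ 1` satisfies `xⁿy = yxⁿ` for all `x, y ∈ G`,
then `G` admits no DTC ultrafilter: for every `v ∈ βG \ G` the ultrafilter
`u := v^{⋄n}` belongs to `βG \ G` and satisfies `u ⋄ v = u ∘ v`. -/
theorem no_dtc_of_pow_central (G : Type*) [Group G] [Infinite G]
    (hFC : ∀ y : G, {z : G | ∃ x : G, x⁻¹ * y * x = z}.Finite)
    (n : ℕ) (hn : 1 ≤ n) (hcomm : ∀ x y : G, x ^ n * y = y * x ^ n) :
    ∀ v : Ultrafilter G, ¬IsPrincipal v →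
      ¬IsPrincipal (dpow v n) ∧ dprod (dpow v n) v = cprod (dpow v n) v := by
  intro v hv
  refine ⟨not_isPrincipal_dpow hv hn, ?_⟩
  rw [dprod_dpow_comm v hn]
  exact dprod_eq_cprod_of_centralizer_mem fun y => centralizer_mem_dpow (hFC y) hn hcomm v
end

section
/- Let G be a countable infinite group satisfying the following condition: there is V ⊆ G such that for every finite F ⊆ G there is x ∈ G with x ∉ F·V ∪ F·x·(F \ V). Then G admits a DTC ultrafilter (G is DTC(1)). -/
open scoped Pointwise

/-- The separation hypothesis, unpacked for words of bounded length in a finite set. -/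
theorem exists_separated {G : Type*} [Group G] {V : Set G}
    (hV : ∀ F : Finset G, ∃ x : G,
      x ∉ (F : Set G) * V ∪ (F : Set G) * {x} * ((F : Set G) \ V)) (F : Finset G) :
    ∃ x : G, (∀ a ∈ F, ∀ b ∈ F, ∀ c ∈ F, ∀ d ∈ F, ∀ e ∈ F, x ≠ a * b * c * d * e) ∧
      (∀ a ∈ F, ∀ w ∈ V, x ≠ a * w) ∧
      (∀ a ∈ F, ∀ b ∈ F, ∀ c ∈ F, ∀ d ∈ F, a * b * x = x * (c * d) → c * d ∈ V) := by
  classical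
  have h_one : (1 : G) ∈ V := by
    obtain ⟨x, hx⟩ := hV {1}
    by_contra h
    refine hx (Or.inr ?_)
    simpa using Set.mul_mem_mul (Set.mul_mem_mul (Set.mem_singleton 1) (Set.mem_singleton x))
      (Set.mem_sdiff_of_mem (Set.mem_singleton 1) h)
  obtain ⟨x, hx⟩ := hV (F * F * F * F * F ∪ F * F ∪ (F * F)⁻¹ ∪ F)
  have hx₁ : ∀ p ∈ F * F * F * F * F ∪ F * F ∪ (F * F)⁻¹ ∪ F, ∀ w ∈ V, x ≠ p * w :=
    fun p hp w hw h => hx (Or.inl ⟨p, hp, w, hw, h.symm⟩)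
  refine ⟨x, fun a ha b hb c hc d hd e he h => ?_, fun a ha => hx₁ a (by simp [ha]),
    fun a ha b hb c hc d hd h => ?_⟩
  · refine hx₁ (a * b * c * d * e) ?_ 1 h_one (by simpa using h)
    have := Finset.mul_mem_mul (Finset.mul_mem_mul (Finset.mul_mem_mul
      (Finset.mul_mem_mul ha hb) hc) hd) he
    simp only [Finset.mem_union]
    tauto
  · by_contra hcd
    have hab := Finset.inv_mem_inv (Finset.mul_mem_mul ha hb)
    have hcd' := Finset.mul_mem_mul hc hd
    refine hx (Or.inr ⟨(a * b)⁻¹ * x, ⟨(a * b)⁻¹, ?_, x, rfl, rfl⟩, c * d, ⟨?_, hcd⟩, ?_⟩)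
    · simp only [Finset.mem_coe, Finset.mem_union]
      tauto
    · simp only [Finset.mem_coe, Finset.mem_union]
      tauto
    · change (a * b)⁻¹ * x * (c * d) = x
      rw [mul_assoc, ← h, inv_mul_cancel_left]

/-- An exhaustion of `G` by finite symmetric sets `F n`, with a sequence `x` such that
`x n` is chosen by `s` from `F n` and lies in `F (n + 1)`. -/
theorem exists_exhaustion {G : Type*} [Group G] [Countable G] (s : Finset G → G) :
    ∃ F : ℕ → Finset G, Monotone F ∧ (∀ g, ∃ n, g ∈ F n) ∧
      (∀ n, ∀ g ∈ F n, g⁻¹ ∈ F n) ∧ ∀ n, s (F n) ∈ F (n + 1) := by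
  classical
  obtain ⟨e, he⟩ := exists_surjective_nat G
  let F : ℕ → Finset G := fun n =>
    Nat.rec ∅ (fun n E => E ∪ {s E, (s E)⁻¹, e n, (e n)⁻¹}) n
  have hF : ∀ n, F (n + 1) = F n ∪ {s (F n), (s (F n))⁻¹, e n, (e n)⁻¹} := fun _ => rfl
  refine ⟨F, monotone_nat_of_le_succ fun n => ?_, fun g => ?_, fun n => ?_, fun n => ?_⟩
  · rw [hF]
    exact Finset.subset_union_left
  · obtain ⟨n, rfl⟩ := he g
    exact ⟨n + 1, by simp [hF]⟩
  · induction n with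
    | zero => simp [F]
    | succ n ih =>
      intro g hg
      simp only [hF, Finset.mem_union, Finset.mem_insert, Finset.mem_singleton] at hg ⊢
      rcases hg with h | rfl | rfl | rfl | rfl
      · exact Or.inl (ih g h)
      all_goals simp
  · simp [hF]

/-- If a countable infinite group `G` has a subset `V` such that for every finite
`F ⊆ G` there is `x ∈ G` with `x ∉ F·V ∪ F·x·(F \ V)`, then `G` admits a DTC ultrafilter. -/
theorem dtc_of_separating_set (G : Type*) [Group G] [Countable G] [Infinite G]
    (V : Set G)
    (hV : ∀ F : Finset G, ∃ x : G,
      x ∉ (F : Set G) * V ∪ (F : Set G) * {x} * ((F : Set G) \ V)) :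
    ∃ v : Ultrafilter G, IsDTC v := by
  classical
  choose s hs₁ hs₂ hs₃ using exists_separated hV
  obtain ⟨F, h_mono, h_cover, h_inv, h_mem⟩ := exists_exhaustion s
  set x : ℕ → G := fun n => s (F n) with hx
  have h_mem_lt : ∀ {n m}, n < m → x n ∈ F m := fun h => h_mono h (h_mem _)
  let A : Set G := {a | ∃ m, ∃ f ∈ F m, a = f * x m}
  refine ⟨(Filter.hyperfilter ℕ).map x, fun u hu h_eq => ?_⟩
  have hA : A ∈ dprod u ((Filter.hyperfilter ℕ).map x) := by
    rw [mem_dprod]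
    refine Filter.mem_of_superset Filter.univ_mem fun g _ => ?_
    change {n | g * x n ∈ A} ∈ Filter.hyperfilter ℕ
    obtain ⟨n₀, hn₀⟩ := h_cover g
    refine Filter.hyperfilter_le_cofinite ?_
    rw [Nat.cofinite_eq_atTop]
    filter_upwards [Filter.eventually_ge_atTop n₀] with n hn
    exact ⟨n, g, h_mono hn hn₀, rfl⟩
  rw [h_eq, mem_cprod] at hA
  change {n | {g | g * x n ∈ A} ∈ u} ∈ Filter.hyperfilter ℕ at hA
  have h_inf : {n | {g | g * x n ∈ A} ∈ u}.Infinite := fun h =>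
    Filter.notMem_hyperfilter_of_finite h hA
  obtain ⟨n, hn⟩ := h_inf.nonempty
  obtain ⟨k, hk, hnk⟩ := h_inf.exists_gt n
  have h_fin : ((F (k + 1) * F (k + 1) * F (k + 1) : Finset G) : Set G)ᶜ ∈ u := by
    rw [Ultrafilter.compl_mem_iff_notMem]
    intro h
    obtain ⟨y, -, hy⟩ := Ultrafilter.eq_pure_of_finite_mem (Finset.finite_toSet _) h
    exact hu ⟨y, hy⟩
  obtain ⟨g, ⟨⟨⟨m, f, hf, hm⟩, ⟨m', f', hf', hm'⟩⟩, hg⟩⟩ :=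
    u.nonempty_of_mem (Filter.inter_mem (Filter.inter_mem hn hk) h_fin)
  have h_large : ∀ {i j a}, i ≤ k → a ∈ F j → g * x i = a * x j → k < j := by
    intro i j a hi ha h
    by_contra! hj
    apply hg
    rw [eq_mul_inv_of_mul_eq h]
    exact Finset.mul_mem_mul (Finset.mul_mem_mul (h_mono (by omega) ha) (h_mem_lt (by omega)))
      (h_inv _ _ (h_mem_lt (by omega)))
  have h_not_lt : ∀ {i j p q a b}, i ≤ k → j ≤ k → a ∈ F p → b ∈ F q →
      g * x i = a * x p → g * x j = b * x q → ¬ p < q := by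
    intro i j p q a b hi hj ha hb h h' hpq
    have hp := h_large hi ha h
    refine hs₁ (F q) b⁻¹ (h_inv _ _ hb) a (h_mono hpq.le ha) (x p) (h_mem_lt hpq) (x i)⁻¹
      (h_inv _ _ (h_mem_lt (by omega))) (x j) (h_mem_lt (by omega)) ?_
    change x q = _
    rw [mul_assoc b⁻¹, ← h, mul_assoc b⁻¹, mul_inv_cancel_right, mul_assoc, h',
      inv_mul_cancel_left]
  have hkm := h_large hnk.le hf hm
  obtain rfl : m = m' := le_antisymm
    (not_lt.1 (h_not_lt le_rfl hnk.le hf' hf hm' hm))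
    (not_lt.1 (h_not_lt hnk.le le_rfl hf hf' hm hm'))
  have hxV := hs₃ (F m) f⁻¹ (h_inv _ _ hf) f' hf' (x n)⁻¹
    (h_inv _ _ (h_mem_lt (hnk.trans hkm))) (x k) (h_mem_lt hkm) (by
      change _ * x m = x m * _
      rw [mul_assoc, ← hm', eq_inv_mul_of_mul_eq hm.symm]
      group)
  exact hs₂ (F k) (x n) (h_mem_lt hnk) _ hxV (by simp [hx])
end

section
/- Let G be a countable infinite group. Suppose there are finite subsets F_n ⊆ G (n ∈ ω) with e_G ∈ F_n = F_n⁻¹, F_n F_n ⊆ F_{n+1} for all n, and G = ⋃_n F_n, and a sequence {x_n} in G such that F_n x_n x_i⁻¹ ∩ F_k x_k x_j⁻¹ = ∅ whenever i, j < k < n, and F_n x_n x_i⁻¹ ∩ F_n x_n x_j⁻¹ = ∅ whenever i < j < n. Then there exist v ∈ βG \ G and W ⊆ G such that W ∈ u ⋄ v for all u ∈ βG and W ∉ u ∘ v for all u ∈ βG \ G; in particular v is a DTC ultrafilter for βG. -/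
open scoped Pointwise

/-- A non-principal ultrafilter contains no finite set. -/
theorem not_mem_of_finite_of_not_isPrincipal {G : Type*} {u : Ultrafilter G}
    (hu : ¬IsPrincipal u) {s : Set G} (hs : s.Finite) : s ∉ u := by
  intro h
  obtain ⟨g, -, hg⟩ := Ultrafilter.eq_pure_of_finite_mem hs h
  exact hu ⟨g, hg⟩

/-- A sequence whose translates `F n * x n * (x i)⁻¹` are separated is injective. -/
theorem injective_of_separating {G : Type*} [Group G] {F : ℕ → Finset G} {x : ℕ → G}
    (hone : ∀ n, (1 : G) ∈ F n)
    (hsep : ∀ i j n : ℕ, i < j → j < n →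
      ((F n : Set G) * {x n * (x i)⁻¹}) ∩ ((F n : Set G) * {x n * (x j)⁻¹}) = ∅) :
    Function.Injective x := by
  refine Function.Injective.of_lt_imp_ne fun i j hij h => ?_
  have hempty := hsep i j (j + 1) hij j.lt_succ_self
  rw [h, Set.inter_self] at hempty
  exact Set.notMem_empty _ (hempty ▸ Set.mul_mem_mul (hone _) (Set.mem_singleton _))

/-- The right translates of `⋃ n, F n * x n` by `(x i)⁻¹` and `(x j)⁻¹` have finite intersection. -/
theorem finite_inter_translates {G : Type*} [Group G] {F : ℕ → Finset G} {x : ℕ → G}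
    (hsep1 : ∀ i j k n : ℕ, i < k → j < k → k < n →
      ((F n : Set G) * {x n * (x i)⁻¹}) ∩ ((F k : Set G) * {x k * (x j)⁻¹}) = ∅)
    (hsep2 : ∀ i j n : ℕ, i < j → j < n →
      ((F n : Set G) * {x n * (x i)⁻¹}) ∩ ((F n : Set G) * {x n * (x j)⁻¹}) = ∅)
    {i j : ℕ} (hij : i < j) :
    ({g | g * x i ∈ ⋃ n, (F n : Set G) * {x n}} ∩
      {g | g * x j ∈ ⋃ n, (F n : Set G) * {x n}}).Finite := by
  have hfin (l : ℕ) : (⋃ n ∈ Set.Iic j, (F n : Set G) * {x n * (x l)⁻¹}).Finite :=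
    (Set.finite_Iic j).biUnion fun n _ => (F n).finite_toSet.mul (Set.finite_singleton _)
  have hmem {g : G} {n l : ℕ} (h : g * x l ∈ (F n : Set G) * {x n}) :
      g ∈ (F n : Set G) * {x n * (x l)⁻¹} := by
    obtain ⟨f, hf, y, rfl, hy⟩ := h
    exact ⟨f, hf, _, rfl, by simp only [← mul_assoc] at hy ⊢; rw [hy, mul_inv_cancel_right]⟩
  refine ((hfin i).union (hfin j)).subset ?_
  rintro g ⟨hgi, hgj⟩
  obtain ⟨n, hn⟩ := Set.mem_iUnion.1 hgi
  obtain ⟨k, hk⟩ := Set.mem_iUnion.1 hgj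
  replace hn := hmem hn
  replace hk := hmem hk
  rcases le_or_gt n j with hnj | hjn
  · exact Or.inl (Set.mem_biUnion hnj hn)
  rcases le_or_gt k j with hkj | hjk
  · exact Or.inr (Set.mem_biUnion hkj hk)
  exfalso
  rcases lt_trichotomy k n with hkn | rfl | hnk
  · exact Set.notMem_empty g (hsep1 i j k n (hij.trans hjk) hjk hkn ▸ ⟨hn, hk⟩)
  · exact Set.notMem_empty g (hsep2 i j k hij hjk ▸ ⟨hn, hk⟩)
  · exact Set.notMem_empty g (hsep1 j i n k hjn (hij.trans hjn) hnk ▸ ⟨hk, hn⟩)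

/-- Condition (ii) implies condition (iii) of the main theorem on countable groups:
given finite sets `F n` with `1 ∈ F n = (F n)⁻¹`, `F n * F n ⊆ F (n+1)`, `G = ⋃ F n`,
and a sequence `x n` satisfying the two separation properties, there are `v ∈ βG \ G`
and `W ⊆ G` with `W ∈ u ⋄ v` for all `u ∈ βG` and `W ∉ u ∘ v` for all `u ∈ βG \ G`;
in particular `v` is a DTC ultrafilter for `βG`. -/
theorem dtc_of_separating_sequence (G : Type*) [Group G] [Countable G] [Infinite G]
    (F : ℕ → Finset G)
    (hone : ∀ n, (1 : G) ∈ F n)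
    (hinv : ∀ n, (F n : Set G)⁻¹ = (F n : Set G))
    (hmul : ∀ n, (F n : Set G) * (F n : Set G) ⊆ (F (n + 1) : Set G))
    (hcover : ∀ g : G, ∃ n, g ∈ F n)
    (x : ℕ → G)
    (hsep1 : ∀ i j k n : ℕ, i < k → j < k → k < n →
      ((F n : Set G) * {x n * (x i)⁻¹}) ∩ ((F k : Set G) * {x k * (x j)⁻¹}) = ∅)
    (hsep2 : ∀ i j n : ℕ, i < j → j < n →
      ((F n : Set G) * {x n * (x i)⁻¹}) ∩ ((F n : Set G) * {x n * (x j)⁻¹}) = ∅) :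
    ∃ v : Ultrafilter G, ¬IsPrincipal v ∧
      (∃ W : Set G, (∀ u : Ultrafilter G, W ∈ dprod u v) ∧
        (∀ u : Ultrafilter G, ¬IsPrincipal u → W ∉ cprod u v)) ∧
      IsDTC v := by
  have hinj := injective_of_separating hone hsep2
  have hmono : Monotone F := monotone_nat_of_le_succ fun n g hg =>
    hmul n ⟨g, hg, 1, hone n, mul_one g⟩
  let v : Ultrafilter G := (Filter.hyperfilter ℕ).map x
  let W : Set G := ⋃ n, (F n : Set G) * {x n}
  have hsub {A : Set ℕ} (hA : A.Subsingleton) : A ∉ Filter.hyperfilter ℕ :=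
    hA.finite.notMem_hyperfilter
  have hv : ¬IsPrincipal v := by
    rintro ⟨y, hy⟩
    have hmem : ({y} : Set G) ∈ v := by
      rw [hy]
      exact Set.mem_singleton y
    exact hsub (Set.subsingleton_singleton.preimage hinj) (Ultrafilter.mem_map.1 hmem)
  have hW (u : Ultrafilter G) : W ∈ dprod u v := by
    rw [mem_dprod]
    refine Filter.univ_mem' fun g => ?_
    obtain ⟨N, hN⟩ := hcover g
    have hlarge : Set.Ici N ∈ Filter.hyperfilter ℕ :=
      Nat.hyperfilter_le_atTop (Filter.mem_atTop N)
    refine Ultrafilter.mem_map.2 (Filter.mem_of_superset (x := Set.Ici N) hlarge fun n hn => ?_)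
    exact Set.mem_iUnion.2 ⟨n, Set.mul_mem_mul (hmono hn hN) (Set.mem_singleton _)⟩
  have hW' (u : Ultrafilter G) (hu : ¬IsPrincipal u) : W ∉ cprod u v := by
    rw [mem_cprod]
    intro h
    refine hsub ?_ (Ultrafilter.mem_map.1 h)
    intro i hi j hj
    by_contra hne
    rcases lt_or_gt_of_ne hne with hij | hji
    · exact not_mem_of_finite_of_not_isPrincipal hu
        (finite_inter_translates hsep1 hsep2 hij) (Filter.inter_mem hi hj)
    · exact not_mem_of_finite_of_not_isPrincipal hu
        (finite_inter_translates hsep1 hsep2 hji) (Filter.inter_mem hj hi)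
  exact ⟨v, hv, ⟨W, hW, hW'⟩, fun u hu heq => hW' u hu (heq ▸ hW u)⟩
end

section
/- Let G be a group satisfying: there is V ⊆ G such that for every finite F ⊆ G there is x ∈ G with x ∉ F·V ∪ F·x·(F \ V). Let H be a group with a surjective homomorphism π : H → G. Then H satisfies the same condition with π⁻¹(V) in place of V: for every finite F ⊆ H there is y ∈ H with y ∉ F·π⁻¹(V) ∪ F·y·(F \ π⁻¹(V)). -/
open scoped Pointwise

/-- The separation condition is inherited from quotients: if `V ⊆ G` witnesses the
condition for `G` and `π : H → G` is a surjective homomorphism, then `π⁻¹(V)`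
witnesses the condition for `H`. -/
theorem separating_set_of_quotient (G H : Type*) [Group G] [Group H]
    (π : H →* G) (hπ : Function.Surjective π) (V : Set G)
    (hV : ∀ F : Finset G, ∃ x : G,
      x ∉ (F : Set G) * V ∪ (F : Set G) * {x} * ((F : Set G) \ V)) :
    ∀ F : Finset H, ∃ y : H,
      y ∉ (F : Set H) * ((⇑π) ⁻¹' V) ∪ (F : Set H) * {y} * ((F : Set H) \ ((⇑π) ⁻¹' V)) := by
  classical
  intro F
  obtain ⟨x, hx⟩ := hV (F.image π)
  obtain ⟨y, rfl⟩ := hπ x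
  refine ⟨y, fun hy => hx ?_⟩
  rcases hy with ⟨f, hf, v, hv, rfl⟩ | ⟨_, ⟨f, hf, z, hz, rfl⟩, w, ⟨hw, hwV⟩, hfw⟩
  · exact .inl ⟨π f, Finset.mem_image_of_mem π hf, π v, hv, (map_mul π f v).symm⟩
  · rw [Set.mem_singleton_iff] at hz
    subst hz
    refine .inr ⟨π f * π z, ⟨π f, Finset.mem_image_of_mem π hf, π z, rfl, rfl⟩, π w,
      ⟨Finset.mem_image_of_mem π hw, hwV⟩, ?_⟩
    simpa using congrArg π hfw
end

section
/- Let G be a countable group such that the quotient G/FINC(G) is countably infinite. Then G satisfies the condition: there is V ⊆ G (namely V = FINC(G)) such that for every finite F ⊆ G there is x ∈ G with x ∉ F·V ∪ F·x·(F \ V); in particular G admits a DTC ultrafilter. -/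
open scoped Pointwise

/-- `FINC(G)`, the subgroup of elements of `G` with finite conjugacy class. -/
def fincSubgroup (G : Type*) [Group G] : Subgroup G where
  carrier := {y : G | {z : G | ∃ x : G, x⁻¹ * y * x = z}.Finite}
  one_mem' := by
    apply Set.Finite.subset (Set.finite_singleton (1 : G))
    rintro z ⟨x, rfl⟩
    simp
  mul_mem' := by
    rintro a b ha hb
    apply Set.Finite.subset (Set.Finite.mul ha hb)
    rintro z ⟨x, rfl⟩
    exact ⟨x⁻¹ * a * x, ⟨x, rfl⟩, x⁻¹ * b * x, ⟨x, rfl⟩, by group⟩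
  inv_mem' := by
    rintro a ha
    apply Set.Finite.subset (Set.Finite.inv ha)
    rintro z ⟨x, rfl⟩
    rw [Set.mem_inv]
    exact ⟨x, by group⟩

/-- Elements with infinite conjugacy class have centralizers of infinite index. -/
theorem not_finiteIndex_centralizer {G : Type*} [Group G] {w : G} (hw : w ∉ fincSubgroup G) :
    ¬(Subgroup.centralizer {w}).FiniteIndex := by
  intro h
  apply hw
  have : Finite (G ⧸ Subgroup.centralizer {w}) := Subgroup.finite_quotient_of_finiteIndex
  refine (Set.finite_range
    fun q : G ⧸ Subgroup.centralizer {w} => q.out * w * q.out⁻¹).subset ?_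
  rintro z ⟨x, rfl⟩
  refine ⟨QuotientGroup.mk x⁻¹, ?_⟩
  obtain ⟨⟨c, hc⟩, h⟩ :=
    QuotientGroup.mk_out_eq_mul (Subgroup.centralizer {w}) x⁻¹
  have hc' : w * c = c * w := Subgroup.mem_centralizer_singleton_iff.mp hc |>.symm
  simp only [h, mul_inv_rev, inv_inv]
  calc x⁻¹ * c * w * (c⁻¹ * x) = x⁻¹ * (c * w) * c⁻¹ * x := by group
    _ = x⁻¹ * w * x := by rw [← hc']; group

/-- A finite union of cosets of subgroups of infinite index is not the whole group, hence the
separation condition for `V = FINC(G)`. -/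
theorem exists_notMem_mul_fincSubgroup {G : Type*} [Group G]
    (hq : Infinite (G ⧸ fincSubgroup G)) (F : Finset G) : ∃ x : G,
      x ∉ (F : Set G) * (fincSubgroup G : Set G) ∪
          (F : Set G) * {x} * ((F : Set G) \ (fincSubgroup G : Set G)) := by
  classical
  by_contra! hcov
  let g : G ⊕ G × G → G := Sum.elim id fun p =>
    if h : ∃ x, p.1 * x * p.2 = x then h.choose else 1
  let H : G ⊕ G × G → Subgroup G :=
    Sum.elim (fun _ => fincSubgroup G) fun p => Subgroup.centralizer {p.2}
  let s : Finset (G ⊕ G × G) := F.disjSum (F ×ˢ F.filter (· ∉ fincSubgroup G))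
  have hcovers : ⋃ i ∈ s, g i • (H i : Set G) = Set.univ := by
    refine Set.eq_univ_of_forall fun x => ?_
    simp only [Set.mem_iUnion, mem_leftCoset_iff]
    rcases hcov x with hx | hx
    · obtain ⟨f, hf, w, hw, rfl⟩ := Set.mem_mul.mp hx
      exact ⟨.inl f, Finset.inl_mem_disjSum.mpr hf, by simpa [g, H] using hw⟩
    · obtain ⟨_, ⟨f, hf, _, rfl, rfl⟩, w, ⟨hw, hwN⟩, hfw⟩ := Set.mem_mul.mp hx
      rename_i x
      refine ⟨.inr (f, w), Finset.inr_mem_disjSum.mpr (by simpa using ⟨hf, hw, hwN⟩), ?_⟩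
      have hex : ∃ x, f * x * w = x := ⟨x, hfw⟩
      have hy := hex.choose_spec
      set y := hex.choose with hy_def
      have hg : g (.inr (f, w)) = y := by simp only [g, Sum.elim_inr, dif_pos hex, hy_def]
      rw [hg]
      change y⁻¹ * x ∈ Subgroup.centralizer {w}
      rw [Subgroup.mem_centralizer_singleton_iff]
      have h1 : x * w = f⁻¹ * x := by rw [eq_inv_mul_iff_mul_eq, ← mul_assoc]; exact hfw
      have h2 : y * w = f⁻¹ * y := by rw [eq_inv_mul_iff_mul_eq, ← mul_assoc]; exact hy
      calc y⁻¹ * x * w = y⁻¹ * (f⁻¹ * y) * y⁻¹ * x := by rw [mul_assoc, h1]; group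
        _ = w * (y⁻¹ * x) := by rw [← h2]; group
  obtain ⟨k, hk, hfin⟩ := Subgroup.exists_finiteIndex_of_leftCoset_cover hcovers
  rcases k with f | ⟨f, w⟩
  · have : (fincSubgroup G).FiniteIndex := hfin
    have : Finite (G ⧸ fincSubgroup G) := Subgroup.finite_quotient_of_finiteIndex
    exact not_finite (G ⧸ fincSubgroup G)
  · have hw := Finset.inr_mem_disjSum.mp hk
    simp only [Finset.mem_product, Finset.mem_filter] at hw
    exact not_finiteIndex_centralizer hw.2.2 hfin

/-- Stages `S n` and points `x n` chosen along the stages: each `x n` avoids the words of length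
at most five in `S n`, in the sense of the separation condition for `V`. -/
theorem exists_separated_seq {G : Type*} [Group G] [Countable G] (V : Subgroup G)
    (hV : ∀ F : Finset G, ∃ x : G,
      x ∉ (F : Set G) * (V : Set G) ∪ (F : Set G) * {x} * ((F : Set G) \ (V : Set G))) :
    ∃ (S : ℕ → Finset G) (x : ℕ → G), Monotone S ∧ (∀ n, 1 ∈ S n) ∧
      (∀ n, ∀ a ∈ S n, a⁻¹ ∈ S n) ∧ (∀ n, x n ∈ S (n + 1)) ∧ (∀ a, ∃ n, a ∈ S n) ∧
      ∀ n, ∀ a ∈ S n, ∀ b ∈ S n, ∀ c ∈ S n, ∀ d ∈ S n, ∀ e ∈ S n, ∀ v ∈ V,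
        x n ≠ a * b * c * d * e * v ∧ (d * e ∉ V → x n ≠ a * b * x n * (d * e)) := by
  classical
  obtain ⟨g, hg⟩ := exists_surjective_nat G
  choose pick hpick using hV
  let x : Finset G → G := fun T => pick (T * T * T * T * T)
  let adj : Finset G → G → Finset G := fun T a => T ∪ {x T, (x T)⁻¹, a, a⁻¹}
  let S : ℕ → Finset G := fun n => Nat.rec {1} (fun k T => adj T (g k)) n
  have hS : ∀ n, S (n + 1) = adj (S n) (g n) := fun n => rfl
  have hmono : Monotone S := monotone_nat_of_le_succ fun n => by
    rw [hS]; exact Finset.subset_union_left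
  have hone : ∀ n, 1 ∈ S n := fun n => hmono (Nat.zero_le n) (Finset.mem_singleton_self 1)
  refine ⟨S, fun n => x (S n), hmono, hone, ?_, ?_, ?_, ?_⟩
  · intro n
    induction n with
    | zero => intro a ha; simp_all [S]
    | succ k ih =>
      intro a ha
      simp only [hS, adj, Finset.mem_union, Finset.mem_insert, Finset.mem_singleton] at ha ⊢
      rcases ha with ha | rfl | rfl | rfl | rfl
      · exact .inl (ih a ha)
      all_goals simp
  · intro n
    simp [hS, adj]
  · intro a
    obtain ⟨n, rfl⟩ := hg a
    exact ⟨n + 1, by simp [hS, adj]⟩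
  · intro n a ha b hb c hc d hd e he v hv
    have hx := hpick (S n * S n * S n * S n * S n)
    rw [Set.mem_union, not_or] at hx
    have h5 : ∀ a ∈ S n, ∀ b ∈ S n, ∀ c ∈ S n, ∀ d ∈ S n, ∀ e ∈ S n,
        a * b * c * d * e ∈ S n * S n * S n * S n * S n := fun a ha b hb c hc d hd e he =>
      Finset.mul_mem_mul (Finset.mul_mem_mul (Finset.mul_mem_mul (Finset.mul_mem_mul
        ha hb) hc) hd) he
    have h2 : ∀ a ∈ S n, ∀ b ∈ S n, a * b ∈ S n * S n * S n * S n * S n := fun a ha b hb => by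
      simpa using h5 a ha b hb 1 (hone n) 1 (hone n) 1 (hone n)
    constructor
    · intro h
      exact hx.1 (Set.mem_mul.mpr ⟨_, Finset.mem_coe.mpr (h5 a ha b hb c hc d hd e he), v, hv,
        h.symm⟩)
    · intro hde h
      exact hx.2 (Set.mem_mul.mpr ⟨_, Set.mul_mem_mul (Finset.mem_coe.mpr (h2 a ha b hb))
        (Set.mem_singleton _), _, ⟨Finset.mem_coe.mpr (h2 d hd e he), hde⟩, h.symm⟩)

/-- The separation condition for a subgroup `V` of a countable group yields a DTC ultrafilter:
any nonprincipal ultrafilter concentrated on the points `x n` works, as witnessed by the set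
`⋃ n, S n * {x n}`. -/
theorem exists_isDTC_of_separation {G : Type*} [Group G] [Countable G] (V : Subgroup G)
    (hV : ∀ F : Finset G, ∃ x : G,
      x ∉ (F : Set G) * (V : Set G) ∪ (F : Set G) * {x} * ((F : Set G) \ (V : Set G))) :
    ∃ v : Ultrafilter G, IsDTC v := by
  obtain ⟨S, x, hmono, hone, hinv, hxS, hexh, hsep⟩ := exists_separated_seq V hV
  have hxmem : ∀ {m n}, m < n → x m ∈ S n := fun {m n} h => hmono h (hxS m)
  have hcoset : ∀ {m n}, m ≠ n → (x m)⁻¹ * x n ∉ V := by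
    have key : ∀ {m n}, m < n → (x m)⁻¹ * x n ∉ V := fun {m n} h hmem =>
      (hsep n _ (hxmem h) 1 (hone n) 1 (hone n) 1 (hone n) 1 (hone n) _ hmem).1 (by simp)
    intro m n h
    rcases h.lt_or_gt with h | h
    · exact key h
    · intro hmem
      exact key h (by simpa using V.inv_mem hmem)
  have hlt : ∀ {n k m m' f f'}, n < k → m < k → m' < k → f ∈ S n → f' ∈ S k →
      f * x n * (x m)⁻¹ ≠ f' * x k * (x m')⁻¹ := by
    intro n k m m' f f' hn hm hm' hf hf' h
    refine (hsep k _ (hinv k _ hf') _ (hmono hn.le hf) _ (hxmem hn) _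
      (hinv k _ (hxmem hm)) _ (hxmem hm') 1 V.one_mem).1 ?_
    calc x k = f'⁻¹ * (f' * x k * (x m')⁻¹) * x m' := by group
      _ = _ := by rw [← h]; group
  have hdisj : ∀ {m m' n n' f f'}, m ≠ m' → m < n → m' < n' → f ∈ S n → f' ∈ S n' →
      f * x n * (x m)⁻¹ ≠ f' * x n' * (x m')⁻¹ := by
    intro m m' n n' f f' hne hm hm' hf hf' h
    rcases lt_trichotomy n n' with hn | rfl | hn
    · exact hlt hn (hm.trans hn) hm' hf hf' h
    · refine (hsep n _ (hinv n _ hf') _ hf 1 (hone n) _ (hinv n _ (hxmem hm)) _ (hxmem hm')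
        1 V.one_mem).2 (hcoset hne) ?_
      calc x n = f'⁻¹ * (f' * x n * (x m')⁻¹) * x m' := by group
        _ = _ := by rw [← h]; group
    · exact hlt hn (hm'.trans hn) hm hf' hf h.symm
  let A : Set G := {z | ∃ n, ∃ f ∈ S n, f * x n = z}
  refine ⟨(Filter.hyperfilter ℕ).map x, fun u hu heq => ?_⟩
  have hucof : (u : Filter G) ≤ Filter.cofinite := u.le_cofinite_or_eq_pure.resolve_right hu
  have hA : A ∈ dprod u ((Filter.hyperfilter ℕ).map x) := by
    rw [mem_dprod]
    refine Filter.univ_mem' fun z => ?_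
    obtain ⟨k, hk⟩ := hexh z
    exact Nat.hyperfilter_le_atTop (Filter.mem_atTop_sets.mpr
      ⟨k, fun n hn => ⟨n, z, hmono hn hk, rfl⟩⟩)
  rw [heq, mem_cprod] at hA
  let M : Set ℕ := {m | {z | z * x m ∈ A} ∈ u}
  have hM : M.Infinite := fun hfin => Filter.notMem_hyperfilter_of_finite hfin hA
  have hlate : ∀ m ∈ M, {z | ∃ n, m < n ∧ ∃ f ∈ S n, f * x n * (x m)⁻¹ = z} ∈ u := by
    intro m hm
    have hfin : (⋃ n ∈ Set.Iic m, (fun f => f * x n * (x m)⁻¹) '' (S n : Set G)).Finite :=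
      (Set.finite_Iic m).biUnion fun n _ => (S n).finite_toSet.image _
    filter_upwards [hm, hucof hfin.compl_mem_cofinite] with z ⟨n, f, hf, hz⟩ hz'
    have hzf : f * x n * (x m)⁻¹ = z := by rw [hz]; group
    refine ⟨n, ?_, f, hf, hzf⟩
    by_contra! hn
    exact hz' (Set.mem_biUnion hn ⟨f, hf, hzf⟩)
  obtain ⟨m, hm, m', hm', hne⟩ := hM.nontrivial
  obtain ⟨z, ⟨n, hn, f, hf, rfl⟩, n', hn', f', hf', hz⟩ :=
    Ultrafilter.nonempty_of_mem (Filter.inter_mem (hlate m hm) (hlate m' hm'))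
  exact hdisj hne hn hn' hf hf' hz.symm

/-- If `G` is a countable group with `|G / FINC(G)| = ℵ₀`, then `V = FINC(G)` witnesses
the separation condition, and `G` admits a DTC ultrafilter. -/
theorem dtc_of_infinite_finc_quotient (G : Type*) [Group G] [Countable G]
    (hq : Infinite (G ⧸ fincSubgroup G)) :
    (∀ F : Finset G, ∃ x : G,
      x ∉ (F : Set G) * (fincSubgroup G : Set G) ∪
          (F : Set G) * {x} * ((F : Set G) \ (fincSubgroup G : Set G))) ∧
    (∃ v : Ultrafilter G, IsDTC v) := by
  exact ⟨exists_notMem_mul_fincSubgroup hq,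
    exists_isDTC_of_separation _ (exists_notMem_mul_fincSubgroup hq)⟩
end

section
/- Every countable ICC group admits a DTC ultrafilter; moreover every countable ICC group G satisfies the condition: there is V ⊆ G such that for every finite F ⊆ G there is x ∈ G with x ∉ F·V ∪ F·x·(F \ V). -/
open scoped Pointwise

/-- `x` lies outside the finite set `K` and conjugates every nontrivial element of `K` out of `K`. -/
def Escapes {G : Type*} [Group G] (K : Finset G) (x : G) : Prop :=
  x ∉ K ∧ ∀ h ∈ K, h ≠ 1 → x * h * x⁻¹ ∉ K

theorem not_finiteIndex_centralizer_of_infinite_conj {G : Type*} [Group G] {h : G}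
    (hh : {z : G | ∃ x : G, x⁻¹ * h * x = z}.Infinite) :
    ¬(Subgroup.centralizer {h}).FiniteIndex := by
  intro hfin
  refine hh ((Set.finite_range
    fun q : G ⧸ Subgroup.centralizer {h} => q.out * h * q.out⁻¹).subset ?_)
  rintro _ ⟨x, rfl⟩
  obtain ⟨c, hc⟩ := QuotientGroup.mk_out_eq_mul (Subgroup.centralizer {h}) x⁻¹
  refine ⟨(x⁻¹ : G), ?_⟩
  have hcomm : h * (c : G) = c * h := Subgroup.mem_centralizer_singleton_iff.1 c.2 |>.symm
  simp only [hc]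
  calc x⁻¹ * c * h * (x⁻¹ * c)⁻¹ = x⁻¹ * (c * h) * (c : G)⁻¹ * x := by group
    _ = x⁻¹ * h * x := by rw [← hcomm]; group

theorem exists_escapes {G : Type*} [Group G] [Infinite G]
    (hicc : ∀ h : G, h ≠ 1 → {z : G | ∃ x : G, x⁻¹ * h * x = z}.Infinite) (K : Finset G) :
    ∃ x, Escapes K x := by
  classical
  by_contra! hK
  let H : G → Subgroup G := fun h => if h = 1 then ⊥ else Subgroup.centralizer {h}
  let g : G × G → G := fun p =>
    if p.1 = 1 then p.2 else Classical.epsilon fun x => x * p.1 * x⁻¹ = p.2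
  have hcover : ⋃ p ∈ insert 1 K ×ˢ K, g p • (H p.1 : Set G) = Set.univ := by
    refine Set.eq_univ_of_forall fun x => ?_
    simp only [Set.mem_iUnion]
    by_cases hx : x ∈ K
    · exact ⟨(1, x), by simp [hx], by simp [g, H]⟩
    · obtain ⟨h, hh, h1, hxh⟩ : ∃ h ∈ K, h ≠ 1 ∧ x * h * x⁻¹ ∈ K := by
        simpa [Escapes, hx] using hK x
      have hg : g (h, x * h * x⁻¹) * h * (g (h, x * h * x⁻¹))⁻¹ = x * h * x⁻¹ := by
        simp only [g, if_neg h1]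
        exact Classical.epsilon_spec (p := fun y => y * h * y⁻¹ = x * h * x⁻¹) ⟨x, rfl⟩
      refine ⟨(h, x * h * x⁻¹), by simp [hh, hxh], ?_⟩
      simp only [H, if_neg h1]
      generalize g (h, x * h * x⁻¹) = y at hg
      rw [mem_leftCoset_iff, SetLike.mem_coe, Subgroup.mem_centralizer_singleton_iff]
      calc y⁻¹ * x * h = y⁻¹ * (x * h * x⁻¹) * x := by group
        _ = h * (y⁻¹ * x) := by rw [← hg]; group
  obtain ⟨⟨h, k⟩, -, hfin⟩ := Subgroup.exists_finiteIndex_of_leftCoset_cover hcover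
  by_cases h1 : h = 1
  · simp only [H, if_pos h1] at hfin
    exact hfin.index_ne_zero (by simp)
  · simp only [H, if_neg h1] at hfin
    exact not_finiteIndex_centralizer_of_infinite_conj (hicc h h1) hfin

theorem exists_escaping_seq {G : Type*} [Group G] [Countable G]
    (hesc : ∀ K : Finset G, ∃ x, Escapes K x) (T : Finset G → Finset G) :
    ∃ (S : ℕ → Finset G) (x : ℕ → G), Monotone S ∧ (∀ g, ∃ n, g ∈ S n) ∧ (∀ n, 1 ∈ S n) ∧
      (∀ n, x n ∈ S (n + 1)) ∧ ∀ n, Escapes (T (S n)) (x n) := by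
  classical
  obtain ⟨e, he⟩ := exists_surjective_nat G
  choose φ hφ using hesc
  let S : ℕ → Finset G := Nat.rec {1} fun n s => insert (e n) (insert (φ (T s)) s)
  have hS (n : ℕ) : S (n + 1) = insert (e n) (insert (φ (T (S n))) (S n)) := rfl
  have hmono : Monotone S := monotone_nat_of_le_succ fun n => by
    rw [hS]
    exact (Finset.subset_insert _ _).trans (Finset.subset_insert _ _)
  refine ⟨S, fun n => φ (T (S n)), hmono, fun g => ?_,
    fun n => hmono n.zero_le (Finset.mem_singleton_self 1), fun n => by simp [hS],
    fun n => hφ _⟩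
  obtain ⟨n, rfl⟩ := he g
  exact ⟨n + 1, by simp [hS]⟩

theorem exists_isDTC_of_escapes {G : Type*} [Group G] [Countable G]
    (hesc : ∀ K : Finset G, ∃ x, Escapes K x) : ∃ v : Ultrafilter G, IsDTC v := by
  classical
  obtain ⟨S, x, hmono, hex, hone, hxS, hx⟩ :=
    exists_escaping_seq hesc fun s => s⁻¹ * s * (s * s⁻¹ * s)
  have hxlt {i n : ℕ} (h : i < n) : x i ∈ S n := hmono h (hxS i)
  have hsub (n : ℕ) : (S n)⁻¹ * S n ⊆ (S n)⁻¹ * S n * (S n * (S n)⁻¹ * S n) :=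
    Finset.subset_mul_left _ (by
      simpa using Finset.mul_mem_mul
        (Finset.mul_mem_mul (hone n) (Finset.inv_mem_inv (hone n))) (hone n))
  have hsub' (n : ℕ) : S n ⊆ (S n)⁻¹ * S n * (S n * (S n)⁻¹ * S n) :=
    (Finset.subset_mul_right _ (by simpa using hone n)).trans (hsub n)
  have hne {i n : ℕ} (h : i < n) : x n ≠ x i := fun heq =>
    (hx n).1 (hsub' n (heq ▸ hxlt h))
  have hfresh {n k i j : ℕ} {f g : G} (hnk : n < k) (hi : i < k) (hj : j < k)
      (hf : f ∈ S n) (hg : g ∈ S k) : f * x n * (x i)⁻¹ ≠ g * x k * (x j)⁻¹ := by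
    intro h
    apply (hx k).1
    have h' : x k = g⁻¹ * f * (x n * (x i)⁻¹ * x j) := by
      calc x k = g⁻¹ * (g * x k * (x j)⁻¹) * x j := by group
        _ = _ := by rw [← h]; group
    rw [h']
    exact Finset.mul_mem_mul (Finset.mul_mem_mul (Finset.inv_mem_inv hg) (hmono hnk.le hf))
      (Finset.mul_mem_mul (Finset.mul_mem_mul (hxlt hnk) (Finset.inv_mem_inv (hxlt hi)))
        (hxlt hj))
  let A : Set G := {a | ∃ n, ∃ f ∈ S n, a = f * x n}
  let W : ℕ → Set G := fun m => {y | y * x m ∈ A}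
  have hWfin {m m' : ℕ} (hm : m < m') : (W m ∩ W m').Finite := by
    let B : ℕ → Set G := fun i => ⋃ n ∈ Set.Iic m', (fun f => f * x n * (x i)⁻¹) '' S n
    have hB (i : ℕ) : (B i).Finite :=
      (Set.finite_Iic m').biUnion fun n _ => (S n).finite_toSet.image _
    refine ((hB m).union (hB m')).subset ?_
    rintro y ⟨⟨n, f, hf, hy⟩, ⟨k, g, hg, hy'⟩⟩
    replace hy := eq_mul_inv_of_mul_eq hy
    replace hy' := eq_mul_inv_of_mul_eq hy'
    by_cases hn : n ≤ m'
    · exact Or.inl (Set.mem_biUnion hn ⟨f, hf, hy.symm⟩)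
    by_cases hk : k ≤ m'
    · exact Or.inr (Set.mem_biUnion hk ⟨g, hg, hy'.symm⟩)
    have h := hy.symm.trans hy'
    exfalso
    push Not at hn hk
    rcases lt_trichotomy n k with hnk | rfl | hnk
    · exact hfresh hnk (hm.trans hk) hk hf hg h
    · refine (hx n).2 ((x m')⁻¹ * x m) (hsub n (Finset.mul_mem_mul
        (Finset.inv_mem_inv (hxlt hn)) (hxlt (hm.trans hn)))) ?_ ?_
      · rw [Ne, inv_mul_eq_one]
        exact hne hm
      · have h' : x n * ((x m')⁻¹ * x m) * (x n)⁻¹ = g⁻¹ * f := by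
          calc x n * ((x m')⁻¹ * x m) * (x n)⁻¹
              = g⁻¹ * (g * x n * (x m')⁻¹) * x m * (x n)⁻¹ := by group
            _ = _ := by rw [← h]; group
        rw [h']
        exact hsub n (Finset.mul_mem_mul (Finset.inv_mem_inv hg) hf)
    · exact hfresh hnk hn (hm.trans hn) hg hf h.symm
  refine ⟨(Filter.hyperfilter ℕ).map x, fun u hu huv => hu ?_⟩
  have hA : A ∈ dprod u ((Filter.hyperfilter ℕ).map x) := by
    rw [mem_dprod]
    refine Filter.univ_mem' fun f => ?_
    obtain ⟨N, hN⟩ := hex f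
    refine Nat.hyperfilter_le_atTop (Filter.mem_of_superset (Filter.Ici_mem_atTop N) ?_)
    exact fun n hn => ⟨n, f, hmono hn hN, rfl⟩
  rw [huv, mem_cprod] at hA
  have hinf : {m | W m ∈ u}.Infinite := fun hfin => hfin.notMem_hyperfilter hA
  obtain ⟨m, hm⟩ := hinf.nonempty
  obtain ⟨m', hm', hlt⟩ := hinf.exists_gt m
  obtain ⟨y, -, hy⟩ := Ultrafilter.eq_pure_of_finite_mem (hWfin hlt) (Filter.inter_mem hm hm')
  exact ⟨y, hy⟩

/-- Every countable ICC group satisfies the separation condition and admits a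
DTC ultrafilter. (`G` is ICC: `G` is infinite and `FINC(G) = {1}`.) -/
theorem dtc_of_icc (G : Type*) [Group G] [Countable G] [Infinite G]
    (hicc : {y : G | {z : G | ∃ x : G, x⁻¹ * y * x = z}.Finite} = {1}) :
    (∃ V : Set G, ∀ F : Finset G, ∃ x : G,
      x ∉ (F : Set G) * V ∪ (F : Set G) * {x} * ((F : Set G) \ V)) ∧
    (∃ v : Ultrafilter G, IsDTC v) := by
  classical
  have hinf : ∀ h : G, h ≠ 1 → {z : G | ∃ x : G, x⁻¹ * h * x = z}.Infinite := by
    intro h h1 hfin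
    exact h1 (hicc.subset hfin)
  refine ⟨⟨{1}, fun F => ?_⟩, exists_isDTC_of_escapes (exists_escapes hinf)⟩
  obtain ⟨x, hxK, hx⟩ := exists_escapes hinf (F ∪ F⁻¹)
  refine ⟨x, ?_⟩
  rintro (hmem | ⟨_, ⟨f, hf, y, hy, rfl⟩, w, ⟨hw, hw1⟩, h⟩)
  · exact hxK (Finset.mem_union_left _ (by simpa using hmem))
  · refine hx w (Finset.mem_union_left _ hw) hw1 (Finset.mem_union_right _ ?_)
    have h' : x * w * x⁻¹ = f⁻¹ := by
      rw [mul_inv_eq_iff_eq_mul, eq_inv_mul_iff_mul_eq, ← mul_assoc]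
      rwa [Set.mem_singleton_iff.1 hy] at h
    rw [h']
    exact Finset.inv_mem_inv hf
end

section
/- Every countable group that has an ICC quotient admits a DTC ultrafilter: if G is a countable group and N is a normal subgroup of G such that G/N is an ICC group, then G admits a DTC ultrafilter. -/
open scoped Pointwise

/-- An element whose centralizer has finite index has a finite conjugacy class. -/
theorem finite_conj_of_finiteIndex_centralizer {Q : Type*} [Group Q] (b : Q)
    (h : (Subgroup.centralizer {b}).FiniteIndex) :
    {z : Q | ∃ x : Q, x⁻¹ * b * x = z}.Finite := by
  have : Finite (Q ⧸ Subgroup.centralizer {b}) := Subgroup.finite_quotient_of_finiteIndex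
  let f : Q ⧸ Subgroup.centralizer {b} → Q := Quotient.lift (fun q => q * b * q⁻¹) <| by
    intro p q hpq
    have hc := Subgroup.mem_centralizer_singleton_iff.mp
      (QuotientGroup.leftRel_apply.mp hpq)
    calc p * b * p⁻¹ = p * (b * (p⁻¹ * q)) * q⁻¹ := by group
      _ = p * (p⁻¹ * q * b) * q⁻¹ := by rw [hc]
      _ = q * b * q⁻¹ := by group
  refine (Set.finite_range f).subset ?_
  rintro _ ⟨x, rfl⟩
  exact ⟨QuotientGroup.mk x⁻¹, by simp [f, QuotientGroup.mk]⟩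

/-- If every nontrivial element of an infinite group `Q` has an infinite conjugacy class, then some
element outside a given finite set conjugates all nontrivial elements of `S` out of `T`. -/
theorem exists_notMem_conj_notMem {Q : Type*} [Group Q] [Infinite Q]
    (hicc : ∀ a : Q, {z : Q | ∃ x : Q, x⁻¹ * a * x = z}.Finite → a = 1) (E S T : Finset Q) :
    ∃ y ∉ E, ∀ a ∈ S, a ≠ 1 → y⁻¹ * a * y ∉ T := by
  classical
  by_contra! hcon
  let H : Q ⊕ Q × Q → Subgroup Q := Sum.elim (fun _ => ⊥) fun p => Subgroup.centralizer {p.2}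
  let c : Q ⊕ Q × Q → Q :=
    Sum.elim id fun p => if h : ∃ y : Q, y⁻¹ * p.1 * y = p.2 then h.choose else 1
  let s : Finset (Q ⊕ Q × Q) := E.disjSum (S ×ˢ T.filter (· ≠ 1))
  have hcov : ⋃ i ∈ s, c i • ((H i : Subgroup Q) : Set Q) = Set.univ := by
    refine Set.eq_univ_of_forall fun q => ?_
    rw [Set.mem_iUnion₂]
    by_cases hq : q ∈ E
    · exact ⟨.inl q, by simp [s, hq], by simp [c, H]⟩
    · obtain ⟨a, haS, ha, haT⟩ := hcon q hq
      have hb : q⁻¹ * a * q ≠ 1 := by simpa using mt (conj_eq_one_iff (a := q⁻¹) (b := a)).mp ha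
      have hex : ∃ y : Q, y⁻¹ * a * y = q⁻¹ * a * q := ⟨q, rfl⟩
      refine ⟨.inr (a, q⁻¹ * a * q), by simpa [s, haS, haT] using hb, ?_⟩
      rw [mem_leftCoset_iff]
      simp only [c, H, Sum.elim_inr, dif_pos hex, SetLike.mem_coe]
      rw [Subgroup.mem_centralizer_singleton_iff]
      have hy := hex.choose_spec
      set y := hex.choose
      calc y⁻¹ * q * (q⁻¹ * a * q) = (y⁻¹ * a * y) * (y⁻¹ * q) := by group
        _ = q⁻¹ * a * q * (y⁻¹ * q) := by rw [hy]
  obtain ⟨i, hi, hfin⟩ := Subgroup.exists_finiteIndex_of_leftCoset_cover hcov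
  rcases i with e | ⟨a, b⟩
  · have : (⊥ : Subgroup Q).FiniteIndex := hfin
    exact this.index_ne_zero (by simp)
  · have hb : b ≠ 1 :=
      (Finset.mem_filter.mp (Finset.mem_product.mp (Finset.inr_mem_disjSum.mp hi)).2).2
    exact hb (hicc b (finite_conj_of_finiteIndex_centralizer b hfin))

/-- If `G ⧸ N` is ICC, then for every finite `K` there is an element `y` that is generic over `K`:
it avoids certain words over `K`, its coset modulo `N` misses `K`, and conjugation by `y` takes no
`a⁻¹ * b` to a `c⁻¹ * d` outside of `N`, for `a b c d ∈ K`. -/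
theorem exists_generic {G : Type*} [Group G] (N : Subgroup G) [N.Normal] [Infinite (G ⧸ N)]
    (hicc : ∀ a : G ⧸ N, {z : G ⧸ N | ∃ x : G ⧸ N, x⁻¹ * a * x = z}.Finite → a = 1)
    (K : Finset G) :
    ∃ y : G, (∀ a ∈ K, ∀ b ∈ K, ∀ c ∈ K, ∀ d ∈ K, ∀ e ∈ K, y ≠ a⁻¹ * b * c * d⁻¹ * e) ∧
      (∀ c ∈ K, y⁻¹ * c ∉ N) ∧
      ∀ a ∈ K, ∀ b ∈ K, ∀ c ∈ K, ∀ d ∈ K, c⁻¹ * d ∉ N → a⁻¹ * b * y ≠ y * (c⁻¹ * d) := by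
  classical
  let π : G → G ⧸ N := QuotientGroup.mk
  obtain ⟨q, hqE, hqS⟩ := exists_notMem_conj_notMem hicc
    ((K⁻¹ * K * K * K⁻¹ * K ∪ K).image π) ((K⁻¹ * K).image π) ((K⁻¹ * K).image π)
  obtain ⟨y, rfl⟩ := QuotientGroup.mk_surjective q
  refine ⟨y, ?_, ?_, ?_⟩
  · rintro a ha b hb c hc d hd e he rfl
    refine hqE (Finset.mem_image_of_mem π (Finset.mem_union_left _ ?_))
    exact Finset.mul_mem_mul (Finset.mul_mem_mul (Finset.mul_mem_mul (Finset.mul_mem_mul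
      (Finset.inv_mem_inv ha) hb) hc) (Finset.inv_mem_inv hd)) he
  · intro c hc hyc
    refine hqE (Finset.mem_image.mpr ⟨c, Finset.mem_union_right _ hc, ?_⟩)
    exact (QuotientGroup.eq.mpr hyc).symm
  · intro a ha b hb c hc d hd hN heq
    have hconj : (π y)⁻¹ * π (a⁻¹ * b) * π y = π (c⁻¹ * d) := by
      rw [mul_assoc, inv_mul_eq_iff_eq_mul]
      exact congrArg π heq
    refine hqS (π (a⁻¹ * b))
      (Finset.mem_image_of_mem π (Finset.mul_mem_mul (Finset.inv_mem_inv ha) hb)) ?_ ?_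
    · intro h1
      refine hN ((QuotientGroup.eq_one_iff _).mp (hconj.symm.trans ?_))
      rw [h1]; simp
    · exact hconj ▸ Finset.mem_image_of_mem π (Finset.mul_mem_mul (Finset.inv_mem_inv hc) hd)

/-- An increasing exhaustion `K` of `G` by finite sets with elements `y n ∈ K (n + 1)` generic
with respect to `K n` yields a DTC ultrafilter. -/
theorem isDTC_map_hyperfilter {G : Type*} [Group G] (N : Subgroup G) (K : ℕ → Finset G)
    (y : ℕ → G) (hK : Monotone K) (hKtop : ∀ x, ∃ n, x ∈ K n) (hy : ∀ n, y n ∈ K (n + 1))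
    (hword : ∀ n, ∀ a ∈ K n, ∀ b ∈ K n, ∀ c ∈ K n, ∀ d ∈ K n, ∀ e ∈ K n,
      y n ≠ a⁻¹ * b * c * d⁻¹ * e)
    (hN : ∀ n, ∀ c ∈ K n, (y n)⁻¹ * c ∉ N)
    (hconj : ∀ n, ∀ a ∈ K n, ∀ b ∈ K n, ∀ c ∈ K n, ∀ d ∈ K n, c⁻¹ * d ∉ N →
      a⁻¹ * b * y n ≠ y n * (c⁻¹ * d)) :
    IsDTC ((Filter.hyperfilter ℕ).map y) := by
  classical
  have hyK : ∀ {m n}, m < n → y m ∈ K n := fun h => hK h (hy _)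
  intro u hu heq
  have hucof : (u : Filter G) ≤ Filter.cofinite :=
    u.le_cofinite_or_eq_pure.resolve_right hu
  let A : Set G := {g | ∃ n, ∃ x ∈ K n, x * y n = g}
  have hA : A ∈ dprod u ((Filter.hyperfilter ℕ).map y) := by
    refine (mem_dprod _ _ _).mpr (Filter.Eventually.of_forall fun x => ?_)
    obtain ⟨n, hn⟩ := hKtop x
    exact Nat.hyperfilter_le_atTop (Filter.mem_atTop_sets.mpr
      ⟨n, fun m hm => ⟨m, x, hK hm hn, rfl⟩⟩)
  have hev : ∀ᶠ n in (Filter.hyperfilter ℕ : Filter ℕ), ∀ᶠ x in (u : Filter G), x * y n ∈ A :=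
    (mem_cprod _ _ _).mp (heq ▸ hA)
  obtain ⟨p, hp⟩ := hev.exists
  obtain ⟨q, hq, hpq⟩ :=
    (hev.and (Nat.hyperfilter_le_atTop (Filter.eventually_gt_atTop p))).exists
  let L := K (q + 1)
  have hfin : ∀ᶠ x in (u : Filter G), x ∉ L * L * L⁻¹ :=
    hucof (L * L * L⁻¹).finite_toSet.compl_mem_cofinite
  have hlarge : ∀ {x a m k}, x ∉ L * L * L⁻¹ → k ≤ q → a ∈ K m → a * y m = x * y k → q < m := by
    intro x a m k hx hk ha hax
    by_contra! hm
    refine hx ?_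
    rw [← mul_inv_eq_of_eq_mul hax]
    exact Finset.mul_mem_mul (Finset.mul_mem_mul (hK (by omega) ha) (hyK (by omega)))
      (Finset.inv_mem_inv (hyK (by omega)))
  obtain ⟨x, ⟨⟨m, a, ha, hax⟩, ⟨r, b, hb, hbx⟩⟩, hx⟩ := ((hp.and hq).and hfin).exists
  have hm : q < m := hlarge hx hpq.le ha hax
  have hr : q < r := hlarge hx le_rfl hb hbx
  have hxa : x = a * y m * (y p)⁻¹ := eq_mul_inv_of_mul_eq hax.symm
  have hxb : x = b * y r * (y q)⁻¹ := eq_mul_inv_of_mul_eq hbx.symm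
  have key : a * y m * (y p)⁻¹ = b * y r * (y q)⁻¹ := hxa.symm.trans hxb
  rcases lt_trichotomy m r with h | rfl | h
  · refine hword r b hb a (hK h.le ha) (y m) (hyK h) (y p) (hyK (hpq.trans hr)) (y q) (hyK hr) ?_
    calc y r = b⁻¹ * (b * y r * (y q)⁻¹) * y q := by group
      _ = b⁻¹ * a * y m * (y p)⁻¹ * y q := by rw [← key]; group
  · refine hconj m b hb a ha (y q) (hyK hm) (y p) (hyK (hpq.trans hm)) (hN q _ (hyK hpq)) ?_
    calc b⁻¹ * a * y m = b⁻¹ * (a * y m * (y p)⁻¹) * y p := by group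
      _ = y m * ((y q)⁻¹ * y p) := by rw [key]; group
  · refine hword m a ha b (hK h.le hb) (y r) (hyK h) (y q) (hyK hm) (y p) (hyK (hpq.trans hm)) ?_
    calc y m = a⁻¹ * (a * y m * (y p)⁻¹) * y p := by group
      _ = a⁻¹ * b * y r * (y q)⁻¹ * y p := by rw [key]; group

/-- Every countable group with an ICC quotient admits a DTC ultrafilter:
if `N` is a normal subgroup of the countable group `G` such that `G/N` is infinite
and `FINC(G/N) = {1}`, then `G` admits a DTC ultrafilter. -/
theorem dtc_of_icc_quotient (G : Type*) [Group G] [Countable G]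
    (N : Subgroup G) [N.Normal] (hinf : Infinite (G ⧸ N))
    (hicc : {y : G ⧸ N | {z : G ⧸ N | ∃ x : G ⧸ N, x⁻¹ * y * x = z}.Finite} = {1}) :
    ∃ v : Ultrafilter G, IsDTC v := by
  classical
  obtain ⟨g, hg⟩ := exists_surjective_nat G
  choose f hword hN hconj using exists_generic N fun a ha => hicc.subset ha
  let K : ℕ → Finset G := Nat.rec ∅ fun n S => insert (f S) (insert (g n) S)
  have hK : Monotone K := monotone_nat_of_le_succ fun n =>
    (Finset.subset_insert _ _).trans (Finset.subset_insert _ _)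
  refine ⟨_, isDTC_map_hyperfilter N K (fun n => f (K n)) hK (fun x => ?_)
    (fun n => Finset.mem_insert_self _ _) (fun n => hword (K n)) (fun n => hN (K n))
    fun n => hconj (K n)⟩
  obtain ⟨n, rfl⟩ := hg x
  exact ⟨n + 1, Finset.mem_insert_of_mem (Finset.mem_insert_self _ _)⟩
end

section
/- An infinite finitely generated group admits a DTC ultrafilter if and only if it is not virtually abelian. Equivalently, an infinite finitely generated group G does not admit a DTC ultrafilter if and only if G has an abelian subgroup of finite index. -/
open scoped Pointwise

namespace DTC

variable {G : Type*} [Group G]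

/-! ### Virtually abelian groups -/

theorem map_mul_right_not_principal {v : Ultrafilter G} (hv : ¬IsPrincipal v) (g : G) :
    ¬IsPrincipal (v.map (· * g)) := by
  rintro ⟨x, hx⟩
  refine hv ⟨x * g⁻¹, ?_⟩
  have h := congrArg (Ultrafilter.map (· * g⁻¹)) hx
  rw [Ultrafilter.map_map, Ultrafilter.map_pure] at h
  rw [← h]
  convert (Ultrafilter.map_id v).symm using 2
  funext z
  simp

theorem dprod_pure_eq_cprod_pure (u : Ultrafilter G) (y : G) :
    dprod u (pure y) = cprod u (pure y) :=
  Ultrafilter.ext fun _ => Iff.rfl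

theorem dprod_eq_cprod_of_mem_commutative {H : Subgroup G} (hH : ∀ a b : ↥H, a * b = b * a)
    {w : Ultrafilter G} (hw : (H : Set G) ∈ w) (g : G) :
    dprod w (w.map (· * g)) = cprod w (w.map (· * g)) := by
  have hcomm : ∀ a ∈ H, ∀ b ∈ H, a * b = b * a := fun a ha b hb =>
    congrArg Subtype.val (hH ⟨a, ha⟩ ⟨b, hb⟩)
  refine Ultrafilter.ext fun A => ?_
  rw [mem_dprod, mem_cprod, Ultrafilter.mem_map]
  refine Filter.eventually_congr (f := (w : Filter G)) ?_
  filter_upwards [hw] with x hx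
  refine Filter.eventually_congr (f := (w : Filter G)) ?_
  filter_upwards [hw] with z hz
  rw [← mul_assoc, ← mul_assoc, hcomm x hx z hz]

theorem exists_coset_mem (H : Subgroup G) [H.FiniteIndex] (v : Ultrafilter G) :
    ∃ g : G, (H : Set G) ∈ v.map (· * g) := by
  obtain ⟨q, hq⟩ := (v.map (fun x => (QuotientGroup.mk x⁻¹ : G ⧸ H))).eq_pure_of_finite
  obtain ⟨g, rfl⟩ := QuotientGroup.mk_surjective q
  refine ⟨g, ?_⟩
  have h : {(QuotientGroup.mk g : G ⧸ H)} ∈ v.map (fun x => (QuotientGroup.mk x⁻¹ : G ⧸ H)) := by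
    rw [hq]
    exact Ultrafilter.mem_pure.2 rfl
  rw [Ultrafilter.mem_map] at h ⊢
  filter_upwards [h] with x hx
  simpa using QuotientGroup.eq.1 (show (QuotientGroup.mk x⁻¹ : G ⧸ H) = QuotientGroup.mk g from hx)

theorem not_isDTC_of_virtually_abelian [Infinite G] {H : Subgroup G} (hfin : H.FiniteIndex)
    (hH : ∀ a b : ↥H, a * b = b * a) (v : Ultrafilter G) : ¬IsDTC v := by
  intro hv
  by_cases hp : IsPrincipal v
  · obtain ⟨y, rfl⟩ := hp
    refine hv (Filter.hyperfilter G) ?_ (dprod_pure_eq_cprod_pure _ y)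
    rintro ⟨x, hx⟩
    refine Filter.notMem_hyperfilter_of_finite (Set.finite_singleton x) ?_
    rw [hx]
    exact Ultrafilter.mem_pure.2 rfl
  · obtain ⟨g, hg⟩ := exists_coset_mem H v
    have h := dprod_eq_cprod_of_mem_commutative hH hg g⁻¹
    have hvw : (v.map (· * g)).map (· * g⁻¹) = v := by
      rw [Ultrafilter.map_map]
      convert Ultrafilter.map_id v using 2
      funext z
      simp
    rw [hvw] at h
    exact hv _ (map_mul_right_not_principal hp g) h

/-! ### The FC-centre -/

/-- The subgroup of elements whose centralizer has finite index. -/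
def fcCenter (G : Type*) [Group G] : Subgroup G where
  carrier := {g | (Subgroup.centralizer {g}).FiniteIndex}
  one_mem' := by
    have h : Subgroup.centralizer {(1 : G)} = ⊤ := by
      ext x
      simp [Subgroup.mem_centralizer_singleton_iff]
    simp only [Set.mem_ofPred_eq, h]
    infer_instance
  mul_mem' := by
    intro a b ha hb
    simp only [Set.mem_ofPred_eq] at ha hb ⊢
    refine Subgroup.finiteIndex_of_le
      (H := Subgroup.centralizer {a} ⊓ Subgroup.centralizer {b}) fun x hx => ?_
    obtain ⟨h1, h2⟩ := Subgroup.mem_inf.1 hx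
    rw [Subgroup.mem_centralizer_singleton_iff] at h1 h2 ⊢
    rw [← mul_assoc, h1, mul_assoc, h2, mul_assoc]
  inv_mem' := by
    intro a ha
    simp only [Set.mem_ofPred_eq] at ha ⊢
    refine Subgroup.finiteIndex_of_le (H := Subgroup.centralizer {a}) fun x hx => ?_
    rw [Subgroup.mem_centralizer_singleton_iff] at hx ⊢
    exact Commute.inv_right hx

theorem mem_fcCenter {g : G} : g ∈ fcCenter G ↔ (Subgroup.centralizer {g}).FiniteIndex := Iff.rfl

theorem virtually_abelian_of_finiteIndex_fcCenter [Group.FG G] (h : (fcCenter G).FiniteIndex) :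
    ∃ H : Subgroup G, H.FiniteIndex ∧ ∀ a b : ↥H, a * b = b * a := by
  obtain ⟨T, hT⟩ : (fcCenter G).FG := (Group.fg_iff_subgroup_fg _).1 inferInstance
  have hK : (⨅ t ∈ T, Subgroup.centralizer {t}).FiniteIndex :=
    Subgroup.finiteIndex_iInf' _ fun t ht =>
      mem_fcCenter.1 (hT ▸ Subgroup.subset_closure ht)
  have hcomm : ∀ k ∈ ⨅ t ∈ T, Subgroup.centralizer {t}, ∀ x ∈ fcCenter G, k * x = x * k := by
    intro k hk x hx
    have hle : fcCenter G ≤ Subgroup.centralizer {k} := by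
      rw [← hT, Subgroup.closure_le]
      intro t ht
      have := Subgroup.mem_centralizer_singleton_iff.1
        ((Subgroup.mem_iInf.1 ((Subgroup.mem_iInf.1 hk) t)) ht)
      exact Subgroup.mem_centralizer_singleton_iff.2 this.symm
    exact (Subgroup.mem_centralizer_singleton_iff.1 (hle hx)).symm
  refine ⟨(⨅ t ∈ T, Subgroup.centralizer {t}) ⊓ fcCenter G, inferInstance, ?_⟩
  rintro ⟨a, ha⟩ ⟨b, hb⟩
  exact Subtype.ext (hcomm a (Subgroup.mem_inf.1 ha).1 b (Subgroup.mem_inf.1 hb).2)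

/-! ### Sets covered by finitely many cosets of subgroups of infinite index -/

/-- A set is small if it is covered by finitely many left cosets of subgroups of infinite index. -/
def IsSmall (X : Set G) : Prop :=
  ∃ s : Finset (G × Subgroup G), (∀ p ∈ s, ¬p.2.FiniteIndex) ∧ X ⊆ ⋃ p ∈ s, p.1 • (p.2 : Set G)

theorem IsSmall.exists_notMem {X : Set G} (hX : IsSmall X) : ∃ z, z ∉ X := by
  by_contra! h
  obtain ⟨s, hs, hX⟩ := hX
  obtain ⟨p, hp, hfin⟩ := Subgroup.exists_finiteIndex_of_leftCoset_cover
    (g := Prod.fst) (H := Prod.snd) (s := s)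
    (Set.eq_univ_of_univ_subset fun z _ => hX (h z))
  exact hs p hp hfin

theorem isSmall_empty : IsSmall (∅ : Set G) := ⟨∅, by simp, Set.empty_subset _⟩

theorem IsSmall.union {X Y : Set G} (hX : IsSmall X) (hY : IsSmall Y) : IsSmall (X ∪ Y) := by
  classical
  obtain ⟨s, hs, hX⟩ := hX
  obtain ⟨t, ht, hY⟩ := hY
  refine ⟨s ∪ t, fun p hp => (Finset.mem_union.1 hp).elim (hs p) (ht p), ?_⟩
  rw [Finset.set_biUnion_union]
  exact Set.union_subset_union hX hY

theorem isSmall_biUnion {ι : Type*} (s : Finset ι) {X : ι → Set G}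
    (h : ∀ i ∈ s, IsSmall (X i)) : IsSmall (⋃ i ∈ s, X i) := by
  classical
  induction s using Finset.induction_on with
  | empty => simpa using isSmall_empty
  | insert a s _ ih =>
    rw [Finset.set_biUnion_insert]
    exact (h a (Finset.mem_insert_self _ _)).union
      (ih fun i hi => h i (Finset.mem_insert_of_mem hi))

theorem isSmall_of_forall_inv_mul_mem {X : Set G} (H : Subgroup G) (hH : ¬H.FiniteIndex)
    (hX : ∀ a ∈ X, ∀ b ∈ X, a⁻¹ * b ∈ H) : IsSmall X := by
  rcases X.eq_empty_or_nonempty with rfl | ⟨a, ha⟩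
  · exact isSmall_empty
  · refine ⟨{(a, H)}, by simpa using hH, fun b hb => ?_⟩
    simpa [mem_leftCoset_iff] using hX a ha b hb

theorem isSmall_of_subsingleton [Infinite G] {X : Set G} (hX : X.Subsingleton) : IsSmall X := by
  refine isSmall_of_forall_inv_mul_mem ⊥ (fun h => ?_) fun a ha b hb => by simp [hX ha hb]
  exact h.index_ne_zero (by simp [Subgroup.index_bot])

/-! ### The construction of a DTC ultrafilter -/

theorem exists_generic [Infinite G] (h : ¬(fcCenter G).FiniteIndex) (F s : Finset G) :
    ∃ z : G, (∀ f ∈ F, ∀ f' ∈ F, ∀ a ∈ s, ∀ b ∈ s, ∀ c ∈ s, f * z ≠ f' * (a * b⁻¹ * c)) ∧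
      (∀ f ∈ F, ∀ f' ∈ F, ∀ a ∈ s, ∀ b ∈ s, a⁻¹ * b ∉ fcCenter G →
        f * z * (a⁻¹ * b) ≠ f' * z) ∧
      ∀ a ∈ s, a⁻¹ * z ∉ fcCenter G := by
  have h1 : IsSmall (⋃ f ∈ F, ⋃ f' ∈ F, ⋃ a ∈ s, ⋃ b ∈ s, ⋃ c ∈ s,
      {z : G | f * z = f' * (a * b⁻¹ * c)}) := by
    refine isSmall_biUnion _ fun f _ => isSmall_biUnion _ fun f' _ => isSmall_biUnion _ fun a _ =>
      isSmall_biUnion _ fun b _ => isSmall_biUnion _ fun c _ => isSmall_of_subsingleton ?_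
    intro z hz z' hz'
    exact mul_left_cancel (Eq.trans hz (Eq.symm hz'))
  have h2 : IsSmall (⋃ f ∈ F, ⋃ f' ∈ F, ⋃ a ∈ s, ⋃ b ∈ s,
      {z : G | a⁻¹ * b ∉ fcCenter G ∧ f * z * (a⁻¹ * b) = f' * z}) := by
    refine isSmall_biUnion _ fun f _ => isSmall_biUnion _ fun f' _ => isSmall_biUnion _ fun a _ =>
      isSmall_biUnion _ fun b _ => ?_
    by_cases hab : a⁻¹ * b ∈ fcCenter G
    · simpa [hab] using isSmall_empty
    refine isSmall_of_forall_inv_mul_mem _ hab ?_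
    rintro z ⟨_, hz⟩ z' ⟨_, hz'⟩
    rw [Subgroup.mem_centralizer_singleton_iff]
    generalize a⁻¹ * b = d at hz hz'
    have e : z * d * z⁻¹ = z' * d * z'⁻¹ := by
      rw [mul_inv_eq_iff_eq_mul, ← mul_right_inj f, ← mul_assoc f z d, hz,
        ← mul_assoc f, ← mul_assoc f, ← mul_assoc f, hz']
      group
    calc z⁻¹ * z' * d = z⁻¹ * (z' * d * z'⁻¹) * z' := by group
      _ = z⁻¹ * (z * d * z⁻¹) * z' := by rw [e]
      _ = d * (z⁻¹ * z') := by group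
  have h3 : IsSmall (⋃ a ∈ s, {z : G | a⁻¹ * z ∈ fcCenter G}) := by
    refine isSmall_biUnion _ fun a _ => isSmall_of_forall_inv_mul_mem _ h fun z hz z' hz' => ?_
    have := (fcCenter G).mul_mem ((fcCenter G).inv_mem hz) hz'
    rwa [mul_inv_rev, inv_inv, mul_assoc, mul_inv_cancel_left] at this
  obtain ⟨z, hz⟩ := ((h1.union h2).union h3).exists_notMem
  simp only [Set.mem_union, Set.mem_iUnion, Set.mem_ofPred_eq, not_or, not_exists, not_and,
    exists_prop] at hz
  exact ⟨z, hz.1.1, hz.1.2, hz.2⟩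

theorem exists_seq_of_forall_finset {α : Type*} [DecidableEq α] {P : ℕ → Finset α → α → Prop}
    (h : ∀ m s, ∃ z, P m s z) : ∃ y : ℕ → α, ∀ m, P m ((Finset.range m).image y) (y m) := by
  choose c hc using h
  let s : ℕ → Finset α := fun n => Nat.rec ∅ (fun m t => insert (c m t) t) n
  have hs : ∀ m, s m = (Finset.range m).image fun n => c n (s n) := by
    intro m
    induction m with
    | zero => rfl
    | succ m ih =>
      rw [Finset.range_add_one, Finset.image_insert, ← ih]
  exact ⟨fun n => c n (s n), fun m => hs m ▸ hc m (s m)⟩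

theorem exists_isDTC [Infinite G] [Countable G] (h : ¬(fcCenter G).FiniteIndex) :
    ∃ v : Ultrafilter G, IsDTC v := by
  classical
  obtain ⟨e, he⟩ := exists_surjective_nat G
  let F : ℕ → Finset G := fun m => (Finset.range m).image e
  have hF : Monotone F := fun m n hmn =>
    Finset.image_subset_image (Finset.range_mono hmn)
  obtain ⟨y, hy⟩ := exists_seq_of_forall_finset fun m s => exists_generic h (F m) s
  have hmem {i m : ℕ} (him : i < m) : y i ∈ (Finset.range m).image y :=
    Finset.mem_image_of_mem y (Finset.mem_range.2 him)
  have hfc {i j : ℕ} (hij : i ≠ j) : (y i)⁻¹ * y j ∉ fcCenter G := by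
    rcases lt_or_gt_of_ne hij with hlt | hlt
    · exact (hy j).2.2 _ (hmem hlt)
    · intro hm
      refine (hy i).2.2 _ (hmem hlt) ?_
      simpa using inv_mem hm
  refine ⟨(Filter.hyperfilter ℕ).map y, fun u hu heq => ?_⟩
  let A : Set G := {a | ∃ m, ∃ f ∈ F m, a = f * y m}
  have hA : A ∈ dprod u ((Filter.hyperfilter ℕ).map y) := by
    rw [mem_dprod]
    refine Filter.univ_mem' fun x => ?_
    obtain ⟨k, rfl⟩ := he x
    refine Filter.mem_hyperfilter_of_finite_compl ((Set.finite_Iic k).subset fun m hm => ?_)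
    by_contra hk
    exact hm ⟨m, e k, Finset.mem_image_of_mem e (Finset.mem_range.2 (not_le.1 hk)), rfl⟩
  rw [heq, mem_cprod, Ultrafilter.mem_map] at hA
  have hinf : (y ⁻¹' {b | {x | x * b ∈ A} ∈ u}).Infinite := fun hfin =>
    Filter.notMem_hyperfilter_of_finite hfin hA
  obtain ⟨i, hi⟩ := hinf.nonempty
  obtain ⟨j, hj, hji⟩ := hinf.exists_notMem_finset {i}
  have hij : i ≠ j := fun hij => hji (by simp [hij])
  have hlarge {n : ℕ} (hn : {x | x * y n ∈ A} ∈ u) :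
      {x | ∃ m > max i j, ∃ f ∈ F m, x * y n = f * y m} ∈ u := by
    have hfin : (⋃ m ∈ Finset.range (max i j + 1),
        (F m).image (fun f => f * y m * (y n)⁻¹) : Set G).Finite :=
      (Finset.finite_toSet _).biUnion fun m _ => Finset.finite_toSet _
    have hnot := (Ultrafilter.compl_mem_iff_notMem (f := u)).2 fun hm =>
      hu ((u.eq_pure_of_finite_mem hfin hm).imp fun _ hx => hx.2)
    filter_upwards [hn, hnot] with x hx hx'
    obtain ⟨m, f, hf, hxf⟩ := hx
    refine ⟨m, ?_, f, hf, hxf⟩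
    by_contra hm
    refine hx' (Set.mem_biUnion (x := m) ?_ ?_)
    · exact Finset.mem_coe.2 (Finset.mem_range.2 (by omega))
    · exact Finset.mem_coe.2 (Finset.mem_image.2 ⟨f, hf, by rw [← hxf, mul_inv_cancel_right]⟩)
  obtain ⟨x, ⟨m, hm, f, hf, hx⟩, m', hm', f', hf', hx'⟩ :=
    u.nonempty_of_mem (Filter.inter_mem (hlarge hi) (hlarge hj))
  obtain ⟨him, hjm⟩ := max_lt_iff.1 hm
  obtain ⟨him', hjm'⟩ := max_lt_iff.1 hm'
  have hxi : x = f * y m * (y i)⁻¹ := eq_mul_inv_of_mul_eq hx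
  have hxj : x = f' * y m' * (y j)⁻¹ := eq_mul_inv_of_mul_eq hx'
  rcases lt_trichotomy m m' with hlt | rfl | hlt
  · refine (hy m').1 f' hf' f (hF hlt.le hf) _ (hmem hlt) _ (hmem him') _ (hmem hjm') ?_
    rw [← hx', hxi]
    group
  · refine (hy m).2.1 f hf f' hf' _ (hmem him) _ (hmem hjm) (hfc hij) ?_
    rw [← hx', hxi]
    group
  · refine (hy m).1 f hf f' (hF hlt.le hf') _ (hmem hlt) _ (hmem hjm) _ (hmem him) ?_
    rw [← hx, hxj]
    group

theorem countable_of_fg [Group.FG G] : Countable G := by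
  obtain ⟨α, hα, φ, hφ⟩ :=
    Group.fg_iff_exists_freeGroup_hom_surjective_finite.1 ‹Group.FG G›
  exact hφ.countable

end DTC

/-- An infinite finitely generated group admits no DTC ultrafilter if and only if
it is virtually abelian. -/
theorem no_dtc_iff_virtually_abelian (G : Type*) [Group G] [Infinite G]
    (hfg : Group.FG G) :
    (¬∃ v : Ultrafilter G, IsDTC v) ↔
      ∃ H : Subgroup G, H.FiniteIndex ∧ ∀ a b : ↥H, a * b = b * a := by
  constructor
  · intro h
    have := DTC.countable_of_fg (G := G)
    by_contra hva
    exact h (DTC.exists_isDTC fun hfc => hva (DTC.virtually_abelian_of_finiteIndex_fcCenter hfc))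
  · rintro ⟨H, hfin, hH⟩ ⟨v, hv⟩
    exact DTC.not_isDTC_of_virtually_abelian hfin hH v hv
end

section
/- Let G be a subgroup of the group of finitary permutations of ℕ (permutations σ of ℕ whose support {n ∈ ℕ : σ(n) ≠ n} is finite) such that G acts transitively on ℕ (for all a, b ∈ ℕ there is σ ∈ G with σ(a) = b). Then G is an ICC group: G is infinite and every σ ∈ G with σ ≠ id has infinite conjugacy class {τ⁻¹στ : τ ∈ G} in G. -/
open scoped Pointwise

/-- A subgroup of the finitary permutations of `ℕ` that acts transitively on `ℕ`
is an ICC group: it is infinite and every nonidentity element has infinite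
conjugacy class in it. -/
theorem icc_of_transitive_finitary (G : Subgroup (Equiv.Perm ℕ))
    (hfin : ∀ σ ∈ G, {n : ℕ | σ n ≠ n}.Finite)
    (htrans : ∀ a b : ℕ, ∃ σ ∈ G, σ a = b) :
    Infinite ↥G ∧
      ∀ σ : ↥G, σ ≠ 1 → {τ : ↥G | ∃ x : ↥G, x⁻¹ * σ * x = τ}.Infinite := by
  refine ⟨Infinite.of_surjective (fun g : ↥G => (g : Equiv.Perm ℕ) 0) fun b => ?_,
    fun σ hσ hclass => ?_⟩
  · obtain ⟨g, hg, hb⟩ := htrans 0 b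
    exact ⟨⟨g, hg⟩, hb⟩
  · obtain ⟨a, ha⟩ : ∃ a, (σ : Equiv.Perm ℕ) a ≠ a := by
      by_contra! h
      exact hσ (Subtype.ext (Equiv.ext h))
    have hsupp := hclass.biUnion fun τ _ => hfin (τ : Equiv.Perm ℕ) τ.2
    refine Set.infinite_univ (hsupp.subset fun b _ => ?_)
    obtain ⟨x, hx, hb⟩ := htrans b a
    refine Set.mem_biUnion (x := (⟨x, hx⟩⁻¹ * σ * ⟨x, hx⟩ : ↥G)) ⟨⟨x, hx⟩, rfl⟩ ?_
    simpa [Equiv.symm_apply_eq, hb] using ha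
end

section
/- Let R be a countable infinite integral domain and P an infinite subgroup of the group of units of R. Let G be the group with underlying set P × R and multiplication (x, r)(y, s) := (xy, r + s·x) (isomorphic to the group of 2×2 matrices [[x, r], [0, 1]] with x ∈ P, r ∈ R under matrix multiplication; identity (1, 0), inverse (x, r)⁻¹ = (x⁻¹, −r·x⁻¹)). Then G is an ICC group: every element (y, s) ≠ (1, 0) has infinite conjugacy class in G. -/
open scoped Pointwise

/-- The group with underlying set `P × R` and multiplication
`(x, r)(y, s) = (xy, r + s·x)`, that is, the matrix group `[[x, r], [0, 1]]`. -/
@[ext] structure Aff (R : Type*) [CommRing R] (P : Subgroup Rˣ) where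
  fst : P
  snd : R

namespace Aff

variable {R : Type*} [CommRing R] {P : Subgroup Rˣ}

instance : Mul (Aff R P) :=
  ⟨fun a b => ⟨a.fst * b.fst, a.snd + b.snd * ((a.fst : Rˣ) : R)⟩⟩

instance : One (Aff R P) := ⟨⟨1, 0⟩⟩

instance : Inv (Aff R P) :=
  ⟨fun a => ⟨a.fst⁻¹, -a.snd * (((a.fst⁻¹ : P) : Rˣ) : R)⟩⟩

@[simp] lemma mul_fst (a b : Aff R P) : (a * b).fst = a.fst * b.fst := rfl
@[simp] lemma mul_snd (a b : Aff R P) :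
    (a * b).snd = a.snd + b.snd * ((a.fst : Rˣ) : R) := rfl
@[simp] lemma one_fst : (1 : Aff R P).fst = 1 := rfl
@[simp] lemma one_snd : (1 : Aff R P).snd = 0 := rfl
@[simp] lemma inv_fst (a : Aff R P) : (a⁻¹).fst = a.fst⁻¹ := rfl
@[simp] lemma inv_snd (a : Aff R P) :
    (a⁻¹).snd = -a.snd * (((a.fst⁻¹ : P) : Rˣ) : R) := rfl

instance : Group (Aff R P) where
  mul_assoc a b c := by ext <;> simp [mul_assoc] <;> push_cast <;> ring
  one_mul a := by ext <;> simp
  mul_one a := by ext <;> simp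
  inv_mul_cancel a := by ext <;> simp

end Aff

/-- For a countable infinite integral domain `R` and an infinite subgroup `P` of its
group of units, the group `G = {[[x, r], [0, 1]] : x ∈ P, r ∈ R}` is ICC:
it is infinite and every element `≠ (1, 0)` has infinite conjugacy class. -/
theorem aff_icc (R : Type*) [CommRing R] [IsDomain R] [Countable R] [Infinite R]
    (P : Subgroup Rˣ) [Infinite P] :
    Infinite (Aff R P) ∧
      ∀ g : Aff R P, g ≠ 1 →
        {h : Aff R P | ∃ x : Aff R P, x⁻¹ * g * x = h}.Infinite := by
  have aff_infinite : Infinite (Aff R P) :=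
    Infinite.of_injective (fun r : R => (⟨1, r⟩ : Aff R P)) fun r s h => congrArg Aff.snd h
  refine ⟨aff_infinite, fun g hg => ?_⟩
  by_cases hy : g.fst = 1
  · have hs : g.snd ≠ 0 := fun h => hg (Aff.ext hy h)
    refine (Set.infinite_range_of_injective
      (f := fun p : P => (⟨p, 0⟩ : Aff R P)⁻¹ * g * ⟨p, 0⟩) fun p q h => ?_).mono ?_
    · have h2 := congrArg Aff.snd h
      exact Subtype.ext (Units.ext (by simpa [hs] using h2))
    · rintro _ ⟨p, rfl⟩
      exact ⟨_, rfl⟩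
  · have hy' : ((g.fst : Rˣ) : R) - 1 ≠ 0 := fun h =>
      hy (Subtype.ext (Units.ext (by simpa using sub_eq_zero.mp h)))
    refine (Set.infinite_range_of_injective
      (f := fun r : R => (⟨1, r⟩ : Aff R P)⁻¹ * g * ⟨1, r⟩) fun r s h => ?_).mono ?_
    · have h2 := congrArg Aff.snd h
      simp only [Aff.mul_snd, Aff.mul_fst, Aff.inv_snd, Aff.inv_fst, inv_one, one_mul,
        OneMemClass.coe_one, Units.val_one, mul_one] at h2
      exact mul_left_cancel₀ hy' (by linear_combination h2)
    · rintro _ ⟨r, rfl⟩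
      exact ⟨_, rfl⟩
end
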